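/- There exists a constant C > 0 such that for every r ∈ (0,∞) and every point z' = ⟨θ',φ'⟩ ∈ S², the heat kernel K_r(z,z') := ∑_{(ℓ,m)∈ℕ×ℤ, |m|≤ℓ} exp(−r² λ_{ℓ,m}) Y_{ℓ,m}(z) conj(Y_{ℓ,m}(z')) (the series converges absolutely) satisfies ∫_{S²} |K_r(z,z')|² dσ(z) ≤ C (min{1, r² max{r, |θ'|}})^{−1}. (This is the on-diagonal bound ⦀K_{exp(−r²L)}⦀_{2,0,0,r} ≤ C, written using the equivalence of the sub-Riemannian ball volume V(⟨θ',φ'⟩, r) with min{1, r² max{r, |θ'|}}.) -/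

import Mathlib

open MeasureTheory Set
open scoped ENNReal NNReal

noncomputable section

/-- The Legendre polynomial `P_ℓ(x) = (2^ℓ ℓ!)⁻¹ (d/dx)^ℓ (x²−1)^ℓ`. -/
def legendreP (n : ℕ) (x : ℝ) : ℝ :=
  ((2:ℝ)^n * (Nat.factorial n : ℝ))⁻¹ * iteratedDeriv n (fun y => (y^2 - 1)^n) x

/-- The associated Legendre function `P_ℓ^m` for `0 ≤ m ≤ ℓ`
(on `[-1,1]`, where `√(1-x²)^m = (1-x²)^{m/2}`). -/
def assocP (n m : ℕ) (x : ℝ) : ℝ :=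
  (-1:ℝ)^m * Real.sqrt (1 - x^2) ^ m * iteratedDeriv m (legendreP n) x

/-- The associated Legendre function `P_ℓ^m` for integer `m` with `|m| ≤ ℓ`. -/
def assocPZ (n : ℕ) (m : ℤ) (x : ℝ) : ℝ :=
  if 0 ≤ m then assocP n m.toNat x
  else (-1:ℝ)^m.natAbs *
    ((Nat.factorial (n - m.natAbs) : ℝ) / (Nat.factorial (n + m.natAbs) : ℝ)) *
    assocP n m.natAbs x

/-- `Ỹ_{ℓ,m}(x) = ((2ℓ+1)/(4π) · (ℓ−m)!/(ℓ+m)!)^{1/2} P_ℓ^m(x)`. -/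
def tY (n : ℕ) (m : ℤ) (x : ℝ) : ℝ :=
  Real.sqrt (((2*(n:ℝ)+1) / (4*Real.pi)) *
    ((Nat.factorial ((n : ℤ) - m).toNat : ℝ) / (Nat.factorial ((n : ℤ) + m).toNat : ℝ))) *
  assocPZ n m x

/-- Euclidean `ℝ³`. -/
abbrev E3 : Type := EuclideanSpace ℝ (Fin 3)

/-- The point `⟨θ,φ⟩ = (cosθ cosφ, cosθ sinφ, sinθ)` of the unit sphere. -/
def spt (θ φ : ℝ) : E3 :=
  (WithLp.equiv 2 (Fin 3 → ℝ)).symm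
    ![Real.cos θ * Real.cos φ, Real.cos θ * Real.sin φ, Real.sin θ]

/-- The surface measure `σ` on the unit sphere `S² ⊆ ℝ³` (total mass `4π`),
realised as the pushforward of `cosθ dθ dφ` under the spherical parametrization. -/
def sphereMeasure : Measure E3 :=
  Measure.map (fun p : ℝ × ℝ => spt p.1 p.2)
    (((volume : Measure (ℝ × ℝ)).restrict
        (Set.Ioc (-(Real.pi/2)) (Real.pi/2) ×ˢ Set.Ico (0:ℝ) (2*Real.pi))).withDensity
      (fun p => ENNReal.ofReal (Real.cos p.1)))

/-- The spherical harmonic `Y_{ℓ,m}(⟨θ,φ⟩) = e^{imφ} Ỹ_{ℓ,m}(sinθ)`, written as a function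
of the point `z ∈ S²` (for `z` on the sphere, `e^{im·arg(z₁+iz₂)} = e^{imφ}` whenever
`Ỹ_{ℓ,m}(z₃) ≠ 0`). -/
def Ylm (n : ℕ) (m : ℤ) (z : E3) : ℂ :=
  Complex.exp (Complex.I * (m : ℂ) * (Complex.arg ((z 0 : ℂ) + (z 1 : ℂ) * Complex.I) : ℂ)) *
    (tY n m (z 2) : ℂ)

/-- The eigenvalue `λ_{ℓ,m} = ℓ(ℓ+1) − m²` of the spherical Grushin operator on `Y_{ℓ,m}`. -/
def eigenL (n : ℕ) (m : ℤ) : ℝ := (n : ℝ) * ((n : ℝ) + 1) - (m : ℝ)^2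

/-- The Fourier coefficient `⟨f, Y_{ℓ,m}⟩_{L²(σ)}`. -/
def coeffY (f : E3 → ℂ) (n : ℕ) (m : ℤ) : ℂ :=
  ∫ z, f z * (starRingEnd ℂ) (Ylm n m z) ∂sphereMeasure

/-- The heat kernel `K_{exp(−r²L)}(z,z') = ∑_{(ℓ,m)} e^{−r² λ_{ℓ,m}} Y_{ℓ,m}(z) conj(Y_{ℓ,m}(z'))`
(an absolutely convergent series). -/
def heatKer (r : ℝ) (z z' : E3) : ℂ :=
  ∑' p : {p : ℕ × ℤ // p.2.natAbs ≤ p.1},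
    (Real.exp (-(r^2 * eigenL p.1.1 p.1.2)) : ℂ) *
      Ylm p.1.1 p.1.2 z * (starRingEnd ℂ) (Ylm p.1.1 p.1.2 z')

open Polynomial

/-- The integral of a polynomial over `[-1, 1]`. -/
def polyInt (p : ℝ[X]) : ℝ := ∫ x in (-1 : ℝ)..1, p.eval x

/-- The polynomial `1 - X²`. -/
def wPoly : ℝ[X] := 1 - X ^ 2

@[simp] lemma eval_wPoly (x : ℝ) : wPoly.eval x = 1 - x ^ 2 := by simp [wPoly]

lemma C_two_eq : (C 2 : ℝ[X]) = 2 := map_ofNat C 2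

lemma derivative_wPoly : derivative wPoly = -(2 * X) := by
  simp only [wPoly, derivative_sub, derivative_one, derivative_X_pow]
  simp [C_two_eq]

lemma intervalIntegrable_eval (p : ℝ[X]) (a b : ℝ) :
    IntervalIntegrable (fun x => p.eval x) volume a b :=
  p.continuous.intervalIntegrable a b

lemma polyInt_add (p q : ℝ[X]) : polyInt (p + q) = polyInt p + polyInt q := by
  simp only [polyInt, eval_add]
  exact intervalIntegral.integral_add (intervalIntegrable_eval _ _ _)
    (intervalIntegrable_eval _ _ _)

lemma polyInt_C_mul (c : ℝ) (p : ℝ[X]) : polyInt (C c * p) = c * polyInt p := by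
  simp [polyInt]

/-- Integration over `[-1, 1]` as a linear functional on polynomials. -/
def polyIntL : ℝ[X] →ₗ[ℝ] ℝ where
  toFun := polyInt
  map_add' := polyInt_add
  map_smul' c p := by rw [smul_eq_C_mul, polyInt_C_mul]; rfl

lemma polyInt_sub (p q : ℝ[X]) : polyInt (p - q) = polyInt p - polyInt q :=
  map_sub polyIntL p q

lemma polyInt_sum {ι : Type*} (s : Finset ι) (f : ι → ℝ[X]) :
    polyInt (∑ i ∈ s, f i) = ∑ i ∈ s, polyInt (f i) :=
  map_sum polyIntL f s

lemma polyInt_mono {p q : ℝ[X]} (h : ∀ x ∈ Icc (-1 : ℝ) 1, p.eval x ≤ q.eval x) :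
    polyInt p ≤ polyInt q :=
  intervalIntegral.integral_mono_on (by norm_num) (intervalIntegrable_eval _ _ _)
    (intervalIntegrable_eval _ _ _) h

lemma polyInt_nonneg {p : ℝ[X]} (h : ∀ x ∈ Icc (-1 : ℝ) 1, 0 ≤ p.eval x) : 0 ≤ polyInt p :=
  intervalIntegral.integral_nonneg (by norm_num) h

lemma polyInt_derivative (p : ℝ[X]) : polyInt (derivative p) = p.eval 1 - p.eval (-1) :=
  intervalIntegral.integral_eq_sub_of_hasDerivAt (fun x _ => p.hasDerivAt x)
    (intervalIntegrable_eval _ _ _)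

lemma polyInt_derivative_wPoly_mul (p : ℝ[X]) : polyInt (derivative (wPoly * p)) = 0 := by
  simp only [polyInt_derivative]
  simp

/-- A function vanishing at `-1` whose derivative is dominated by a polynomial that is
nonnegative on `[-1, 1]` is bounded by the integral of that polynomial. -/
lemma le_polyInt_of_deriv_le {F F' : ℝ → ℝ} {B : ℝ[X]} (hF : Continuous F) (h0 : F (-1) = 0)
    (hd : ∀ x ∈ Ioo (-1 : ℝ) 1, HasDerivAt F (F' x) x)
    (hB : ∀ x ∈ Ioo (-1 : ℝ) 1, F' x ≤ B.eval x)
    (hB0 : ∀ x ∈ Icc (-1 : ℝ) 1, 0 ≤ B.eval x) {x : ℝ} (hx : x ∈ Icc (-1 : ℝ) 1) :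
    F x ≤ polyInt B := by
  have hP : ∀ y, HasDerivAt (fun z => ∫ t in (-1 : ℝ)..z, B.eval t) (B.eval y) y := fun y =>
    intervalIntegral.integral_hasDerivAt_right (intervalIntegrable_eval _ _ _)
      (B.continuous.stronglyMeasurableAtFilter _ _) B.continuous.continuousAt
  have hmono : MonotoneOn (fun z => (∫ t in (-1 : ℝ)..z, B.eval t) - F z) (Icc (-1) 1) := by
    apply monotoneOn_of_deriv_nonneg (convex_Icc _ _)
    · exact ((continuous_iff_continuousAt.2 fun y => (hP y).continuousAt).sub hF).continuousOn
    · intro y hy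
      rw [interior_Icc] at hy
      exact ((hP y).sub (hd y hy)).differentiableAt.differentiableWithinAt
    · intro y hy
      rw [interior_Icc] at hy
      refine (sub_nonneg.2 (hB y hy)).trans_eq ((hP y).sub (hd y hy)).deriv.symm
  have h1 := hmono (left_mem_Icc.2 (by norm_num)) hx hx.1
  have h2 : (∫ t in (-1 : ℝ)..x, B.eval t) ≤ polyInt B :=
    intervalIntegral.integral_mono_interval le_rfl hx.1 hx.2
      ((ae_restrict_iff' measurableSet_Ioc).2 (Filter.Eventually.of_forall fun y hy =>
        hB0 y ⟨hy.1.le, hy.2⟩)) (intervalIntegrable_eval _ _ _)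
  simp only [intervalIntegral.integral_same, h0] at h1
  linarith

/-- The differential operator `-(1 - x²) ∂² + 2 (m + 1) x ∂ + m`, conjugate to
`-(1 - x²) ∂² + 2 x ∂ + m² x² / (1 - x²)` through multiplication by `(1 - x²)^(m/2)`. -/
def grushinOp (m : ℕ) (q : ℝ[X]) : ℝ[X] :=
  -(wPoly * derivative (derivative q)) + C (2 * ((m : ℝ) + 1)) * X * derivative q + C (m : ℝ) * q

lemma polyInt_grushinOp (m : ℕ) (p q : ℝ[X]) :
    polyInt (wPoly ^ m * p * grushinOp m q) =
      polyInt (wPoly ^ (m + 1) * derivative p * derivative q)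
        + m * polyInt (wPoly ^ m * p * q) := by
  rw [← polyInt_C_mul, ← polyInt_add, ← sub_eq_zero, ← polyInt_sub,
    ← polyInt_derivative_wPoly_mul (-(wPoly ^ m * p * derivative q))]
  congr 1
  rcases m with _ | m <;>
  simp [grushinOp, derivative_mul, derivative_pow, derivative_wPoly, C_two_eq] <;> ring

section Weighted

variable (k : ℕ) (q : ℝ[X])

lemma polyInt_sq_first_identity (m : ℕ) :
    2 * ((m : ℝ) + 1) * polyInt (X ^ 2 * wPoly ^ m * q ^ 2) =
      polyInt (wPoly ^ (m + 1) * q ^ 2)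
        + 2 * polyInt (X * wPoly ^ (m + 1) * q * derivative q) := by
  rw [← polyInt_C_mul, ← polyInt_C_mul 2, ← polyInt_add, eq_comm, ← sub_eq_zero, ← polyInt_sub,
    ← polyInt_derivative_wPoly_mul (X * wPoly ^ m * q ^ 2)]
  congr 1
  rcases m with _ | m <;>
  simp [derivative_mul, derivative_pow, derivative_wPoly, C_two_eq] <;> ring

/-- The potential term is controlled by the energy. -/
lemma potential_le_energy (m : ℕ) :
    ((m : ℝ) + 1) ^ 2 * polyInt (X ^ 2 * wPoly ^ m * q ^ 2) ≤
      polyInt (wPoly ^ (m + 2) * derivative q ^ 2)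
        + ((m : ℝ) + 1) * polyInt (wPoly ^ (m + 1) * q ^ 2) := by
  have h1 := polyInt_sq_first_identity q m
  have h2 : ((m : ℝ) + 1) * (2 * polyInt (X * wPoly ^ (m + 1) * q * derivative q)) ≤
      ((m : ℝ) + 1) ^ 2 * polyInt (X ^ 2 * wPoly ^ m * q ^ 2)
        + polyInt (wPoly ^ (m + 2) * derivative q ^ 2) := by
    rw [← polyInt_C_mul, ← polyInt_C_mul, ← polyInt_C_mul, ← polyInt_add]
    refine polyInt_mono fun x hx => ?_
    have hw : 0 ≤ 1 - x ^ 2 := by nlinarith [hx.1, hx.2]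
    simp only [eval_mul, eval_add, eval_C, eval_pow, eval_X, eval_wPoly]
    have := mul_nonneg (pow_nonneg hw m)
      (sq_nonneg (((m : ℝ) + 1) * x * q.eval x - (1 - x ^ 2) * (derivative q).eval x))
    ring_nf at this ⊢
    linarith
  nlinarith

lemma polyInt_sq_second_identity :
    2 * ((k : ℝ) + 1) * polyInt (X ^ 4 * wPoly ^ k * q ^ 2) =
      3 * polyInt (X ^ 2 * wPoly ^ (k + 1) * q ^ 2)
        + 2 * polyInt (X ^ 3 * wPoly ^ (k + 1) * q * derivative q) := by
  rw [← polyInt_C_mul, ← polyInt_C_mul 2, ← polyInt_C_mul 3, ← polyInt_add, eq_comm,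
    ← sub_eq_zero, ← polyInt_sub, ← polyInt_derivative_wPoly_mul (X ^ 3 * wPoly ^ k * q ^ 2)]
  congr 1
  rcases k with _ | k <;>
  simp [derivative_mul, derivative_pow, derivative_wPoly, C_two_eq] <;> ring

lemma polyInt_grushinOp_potential :
    polyInt (X ^ 2 * wPoly ^ (k + 1) * q * grushinOp (k + 2) q) =
      polyInt (X ^ 2 * wPoly ^ (k + 2) * derivative q ^ 2)
        + 2 * polyInt (X * wPoly ^ (k + 1) * q * derivative q)
        + ((k : ℝ) + 2) * polyInt (X ^ 2 * wPoly ^ (k + 1) * q ^ 2) := by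
  rw [← polyInt_C_mul, ← polyInt_C_mul, ← polyInt_add, ← polyInt_add, ← sub_eq_zero,
    ← polyInt_sub,
    ← polyInt_derivative_wPoly_mul (-(X ^ 2 * wPoly ^ (k + 1) * q * derivative q))]
  congr 1
  simp [grushinOp, derivative_mul, derivative_pow, derivative_wPoly, C_two_eq]
  simp only [wPoly]
  ring

lemma neg_le_polyInt_cross :
    -(polyInt (wPoly ^ (k + 2) * q ^ 2) + polyInt (X ^ 2 * wPoly ^ (k + 1) * q ^ 2)) ≤
      2 * polyInt (X * wPoly ^ (k + 1) * q * derivative q) := by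
  have h1 := polyInt_sq_first_identity q k
  have h2 : 0 ≤ polyInt (X ^ 2 * wPoly ^ k * q ^ 2) := polyInt_nonneg fun x hx => by
    have hw : 0 ≤ 1 - x ^ 2 := by nlinarith [hx.1, hx.2]
    simp only [eval_mul, eval_pow, eval_X, eval_wPoly]
    positivity
  have h3 : polyInt (wPoly ^ (k + 1) * q ^ 2) =
      polyInt (wPoly ^ (k + 2) * q ^ 2) + polyInt (X ^ 2 * wPoly ^ (k + 1) * q ^ 2) := by
    rw [← polyInt_add]
    congr 1
    simp only [wPoly]
    ring
  have h4 : 0 ≤ 2 * ((k : ℝ) + 1) * polyInt (X ^ 2 * wPoly ^ k * q ^ 2) := by positivity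
  linarith

/-- The square of the potential is controlled by the square of the operator. -/
lemma sq_potential_le :
    ((k : ℝ) + 2) ^ 4 * polyInt (X ^ 4 * wPoly ^ k * q ^ 2) ≤
      (12 * ((k : ℝ) + 2) + 8)
          * (((k : ℝ) + 2) ^ 2 * polyInt (X ^ 2 * wPoly ^ (k + 1) * q ^ 2))
        + 16 * polyInt (wPoly ^ (k + 2) * grushinOp (k + 2) q ^ 2)
        + 8 * (((k : ℝ) + 2) ^ 2 * polyInt (wPoly ^ (k + 2) * q ^ 2)) := by
  have hk : (0 : ℝ) ≤ k := Nat.cast_nonneg k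
  have e1 := polyInt_sq_second_identity k q
  have e2 := polyInt_grushinOp_potential k q
  have e3 := neg_le_polyInt_cross k q
  have hI4 : 0 ≤ polyInt (X ^ 4 * wPoly ^ k * q ^ 2) := polyInt_nonneg fun x hx => by
    have hw : 0 ≤ 1 - x ^ 2 := by nlinarith [hx.1, hx.2]
    simp only [eval_mul, eval_pow, eval_X, eval_wPoly]
    positivity
  have hA : 0 ≤ polyInt (X ^ 2 * wPoly ^ (k + 1) * q ^ 2) := polyInt_nonneg fun x hx => by
    have hw : 0 ≤ 1 - x ^ 2 := by nlinarith [hx.1, hx.2]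
    simp only [eval_mul, eval_pow, eval_X, eval_wPoly]
    positivity
  -- AM-GM for the cross term of the second identity
  have c1 : ((k : ℝ) + 2) * (2 * polyInt (X ^ 3 * wPoly ^ (k + 1) * q * derivative q)) ≤
      ((k : ℝ) + 2) ^ 2 / 2 * polyInt (X ^ 4 * wPoly ^ k * q ^ 2)
        + 2 * polyInt (X ^ 2 * wPoly ^ (k + 2) * derivative q ^ 2) := by
    rw [← polyInt_C_mul, ← polyInt_C_mul, ← polyInt_C_mul, ← polyInt_C_mul, ← polyInt_add]
    refine polyInt_mono fun x hx => ?_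
    have hw : 0 ≤ 1 - x ^ 2 := by nlinarith [hx.1, hx.2]
    simp only [eval_mul, eval_add, eval_C, eval_pow, eval_X, eval_wPoly]
    have := mul_nonneg (pow_nonneg hw k)
      (sq_nonneg (((k : ℝ) + 2) * x ^ 2 * q.eval x - 2 * (x * (1 - x ^ 2) * (derivative q).eval x)))
    ring_nf at this ⊢
    linarith
  have c2 : ((k : ℝ) + 2) ^ 2 * polyInt (X ^ 2 * wPoly ^ (k + 1) * q * grushinOp (k + 2) q) ≤
      2 * polyInt (wPoly ^ (k + 2) * grushinOp (k + 2) q ^ 2)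
        + ((k : ℝ) + 2) ^ 4 / 8 * polyInt (X ^ 4 * wPoly ^ k * q ^ 2) := by
    rw [← polyInt_C_mul, ← polyInt_C_mul, ← polyInt_C_mul, ← polyInt_add]
    refine polyInt_mono fun x hx => ?_
    have hw : 0 ≤ 1 - x ^ 2 := by nlinarith [hx.1, hx.2]
    simp only [eval_mul, eval_add, eval_C, eval_pow, eval_X, eval_wPoly]
    have := mul_nonneg (pow_nonneg hw k)
      (sq_nonneg (((k : ℝ) + 2) ^ 2 * x ^ 2 * q.eval x
        - 4 * ((1 - x ^ 2) * (grushinOp (k + 2) q).eval x)))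
    ring_nf at this ⊢
    linarith
  set m : ℝ := (k : ℝ) + 2 with hm
  have hm2 : 2 ≤ m := by linarith
  have hk1 : (k : ℝ) + 1 = m - 1 := by rw [hm]; ring
  rw [hk1] at e1
  generalize polyInt (X ^ 4 * wPoly ^ k * q ^ 2) = I4 at *
  generalize polyInt (X ^ 2 * wPoly ^ (k + 1) * q ^ 2) = A at *
  generalize polyInt (X ^ 3 * wPoly ^ (k + 1) * q * derivative q) = U at *
  generalize polyInt (X ^ 2 * wPoly ^ (k + 2) * derivative q ^ 2) = R at *
  generalize polyInt (X ^ 2 * wPoly ^ (k + 1) * q * grushinOp (k + 2) q) = T at *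
  generalize polyInt (X * wPoly ^ (k + 1) * q * derivative q) = Z at *
  generalize polyInt (wPoly ^ (k + 2) * grushinOp (k + 2) q ^ 2) = G at *
  generalize polyInt (wPoly ^ (k + 2) * q ^ 2) = N at *
  have d1 : m ^ 2 * I4 ≤ 6 * (m * A) + 4 * R := by
    have : m * (2 * (m - 1) * I4) = m * (3 * A + 2 * U) := by rw [e1]
    nlinarith [mul_nonneg (mul_nonneg (by linarith : 0 ≤ m) (by linarith : 0 ≤ m - 2)) hI4]
  have d2 : m ^ 2 * R ≤ m ^ 2 * T + m ^ 2 * (N + A) := by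
    have : 0 ≤ m ^ 2 * (T - R + (N + A)) := by
      apply mul_nonneg (sq_nonneg m)
      nlinarith [mul_nonneg (by linarith : 0 ≤ m) hA]
    linarith
  have d3 : m ^ 2 * (m ^ 2 * I4) ≤ m ^ 2 * (6 * (m * A) + 4 * R) :=
    mul_le_mul_of_nonneg_left d1 (sq_nonneg m)
  nlinarith

end Weighted

/-- The `k`-th derivative of `(X² - 1) ^ n`. -/
def rodrigues (n k : ℕ) : ℝ[X] := derivative^[k] ((X ^ 2 - 1) ^ n)

lemma derivative_rodrigues (n k : ℕ) : derivative (rodrigues n k) = rodrigues n (k + 1) := by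
  rw [rodrigues, rodrigues, Function.iterate_succ_apply']

lemma rodrigues_ode (n k : ℕ) :
    (X ^ 2 - 1) * rodrigues n (k + 2) + C (2 - 2 * (n : ℝ) + 2 * k) * X * rodrigues n (k + 1)
      + C (((k : ℝ) + 1) * (k - 2 * n)) * rodrigues n k = 0 := by
  induction k with
  | zero =>
    have h : (X ^ 2 - 1) * rodrigues n 1 = C (2 * (n : ℝ)) * X * rodrigues n 0 := by
      rcases n with _ | n
      · simp [rodrigues]
      · simp [rodrigues, derivative_pow, C_two_eq]
        ring
    have h' := congrArg derivative h
    simp only [derivative_mul, derivative_rodrigues, derivative_sub, derivative_X_pow,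
      derivative_one, derivative_C, derivative_X, map_mul, C_two_eq] at h'
    simp [C_two_eq] at h' ⊢
    linear_combination h'
  | succ k ih =>
    have h' := congrArg derivative ih
    simp only [derivative_mul, derivative_rodrigues, derivative_sub, derivative_X_pow,
      derivative_one, derivative_C, derivative_X, derivative_add, derivative_zero, add_assoc,
      Nat.reduceAdd] at h'
    simp [C_two_eq, add_assoc] at h' ⊢
    linear_combination h'

lemma grushinOp_rodrigues (n m : ℕ) :
    grushinOp m (rodrigues n (n + m)) =
      C ((n : ℝ) * (n + 1) - (m : ℝ) ^ 2) * rodrigues n (n + m) := by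
  have h := rodrigues_ode n (n + m)
  simp only [grushinOp, derivative_rodrigues, wPoly, add_assoc] at h ⊢
  simp [C_two_eq] at h ⊢
  linear_combination h

lemma polyInt_grushinOp_comm (m : ℕ) (p q : ℝ[X]) :
    polyInt (wPoly ^ m * p * grushinOp m q) = polyInt (wPoly ^ m * q * grushinOp m p) := by
  rw [polyInt_grushinOp, polyInt_grushinOp, mul_right_comm _ (derivative p), mul_right_comm _ p]

lemma polyInt_rodrigues_of_ne {n n' m : ℕ} (h : n ≠ n') :
    polyInt (wPoly ^ m * rodrigues n (n + m) * rodrigues n' (n' + m)) = 0 := by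
  have e := polyInt_grushinOp_comm m (rodrigues n (n + m)) (rodrigues n' (n' + m))
  rw [grushinOp_rodrigues, grushinOp_rodrigues, mul_left_comm, polyInt_C_mul, mul_left_comm,
    polyInt_C_mul, mul_right_comm _ (rodrigues n' (n' + m))] at e
  have h1 : ((n : ℝ) - n') * (n + n' + 1) ≠ 0 :=
    mul_ne_zero (sub_ne_zero.2 (Nat.cast_injective.ne h)) (by positivity)
  apply mul_left_cancel₀ h1
  linear_combination -e

lemma polyInt_rodrigues_succ (n m : ℕ) :
    polyInt (wPoly ^ (m + 1) * rodrigues n (n + (m + 1)) ^ 2) =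
      ((n : ℝ) - m) * (n + m + 1) * polyInt (wPoly ^ m * rodrigues n (n + m) ^ 2) := by
  have e := polyInt_grushinOp m (rodrigues n (n + m)) (rodrigues n (n + m))
  rw [grushinOp_rodrigues, mul_left_comm, polyInt_C_mul, derivative_rodrigues, mul_assoc,
    mul_assoc, ← sq, ← sq] at e
  simp only [add_assoc] at e ⊢
  linear_combination -e

lemma polyInt_rodrigues_sq_mul_factorial {n m : ℕ} (hm : m ≤ n) :
    polyInt (wPoly ^ m * rodrigues n (n + m) ^ 2) * (n - m).factorial =
      (n + m).factorial * polyInt (rodrigues n n ^ 2) := by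
  induction m with
  | zero => simp [mul_comm]
  | succ m ih =>
    obtain ⟨j, rfl⟩ := Nat.exists_eq_add_of_le hm
    specialize ih (by omega)
    rw [polyInt_rodrigues_succ]
    have h1 : m + 1 + j - m = j + 1 := by omega
    have h2 : m + 1 + j - (m + 1) = j := by omega
    rw [h1, Nat.factorial_succ] at ih
    rw [h2, ← add_assoc (m + 1 + j) m 1, Nat.factorial_succ]
    push_cast at ih ⊢
    linear_combination ((m : ℝ) + 1 + j + m + 1) * ih

lemma polyInt_wPoly_pow (n : ℕ) :
    polyInt (wPoly ^ n) * (2 * n + 1).factorial = 2 ^ (2 * n + 1) * (n.factorial : ℝ) ^ 2 := by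
  induction n with
  | zero => simp [polyInt]; norm_num
  | succ n ih =>
    have h3 : (C 3 : ℝ[X]) = 3 := map_ofNat C 3
    have h : (2 * (n : ℝ) + 3) * polyInt (wPoly ^ (n + 1)) =
        2 * ((n : ℝ) + 1) * polyInt (wPoly ^ n) := by
      rw [← polyInt_C_mul, ← polyInt_C_mul, ← sub_eq_zero, ← polyInt_sub,
        ← polyInt_derivative_wPoly_mul (X * wPoly ^ n)]
      congr 1
      rcases n with _ | n <;>
      simp [derivative_mul, derivative_pow, derivative_wPoly, C_two_eq, h3] <;>
      simp only [wPoly] <;> ring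
    rw [show 2 * (n + 1) + 1 = 2 * n + 1 + 1 + 1 by ring, Nat.factorial_succ (2 * n + 1 + 1),
      Nat.factorial_succ (2 * n + 1), Nat.factorial_succ n]
    push_cast
    linear_combination (2 * (n : ℝ) + 2) * (2 * n + 1).factorial * h
      + (2 * (n : ℝ) + 2) ^ 2 * ih

lemma rodrigues_top (n : ℕ) : rodrigues n (n + n) = C ((2 * n).factorial : ℝ) := by
  have hm : ((X ^ 2 - 1 : ℝ[X]) ^ n).Monic := (monic_X_pow_sub_C (1 : ℝ) two_ne_zero).pow n
  have hd : ((X ^ 2 - 1 : ℝ[X]) ^ n).natDegree = 2 * n := by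
    have h2 : (X ^ 2 - 1 : ℝ[X]).natDegree = 2 := natDegree_X_pow_sub_C (r := (1 : ℝ))
    rw [natDegree_pow, h2, mul_comm]
  rw [rodrigues, ← two_mul, ← factorial_smul_hasseDeriv, LinearMap.smul_apply, ← hd,
    hasseDeriv_natDegree_eq_C, hm.leadingCoeff]
  simp

lemma polyInt_rodrigues_sq (n : ℕ) :
    (2 * (n : ℝ) + 1) * polyInt (rodrigues n n ^ 2) = 2 * (2 ^ n * (n.factorial : ℝ)) ^ 2 := by
  have h := polyInt_rodrigues_sq_mul_factorial (le_refl n)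
  have h2 := polyInt_wPoly_pow n
  rw [rodrigues_top, ← C_pow, mul_comm (wPoly ^ n), polyInt_C_mul, Nat.sub_self,
    ← two_mul] at h
  rw [Nat.factorial_succ] at h2
  have h0 : ((2 * n).factorial : ℝ) ≠ 0 := by positivity
  apply mul_left_cancel₀ h0
  push_cast at h h2
  simp only [Nat.factorial_zero, Nat.cast_one, mul_one] at h
  linear_combination -(2 * (n : ℝ) + 1) * h + (2 * n).factorial * h2

lemma eval_rodrigues_of_sq_eq_one (n : ℕ) {a : ℝ} (ha : a ^ 2 = 1) :
    (rodrigues n n).eval a = (2 * a) ^ n * n.factorial := by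
  have h : taylor a ((X ^ 2 - 1 : ℝ[X]) ^ n) = X ^ n * (X + C (2 * a)) ^ n := by
    rw [← mul_pow, taylor_pow]
    congr 1
    simp only [map_sub, taylor_pow, taylor_X, taylor_one, map_mul, C_two_eq]
    have : (C a : ℝ[X]) ^ 2 = 1 := by rw [← C_pow, ha, C_1]
    simp only [C_1]
    linear_combination this
  rw [rodrigues, ← factorial_smul_hasseDeriv, LinearMap.smul_apply, eval_smul, ← taylor_coeff, h,
    mul_comm (X ^ n), coeff_mul_X_pow', if_pos le_rfl, Nat.sub_self, coeff_zero_eq_eval_zero]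
  simp [mul_comm]

/-- The Sonin function of the Legendre equation is monotone in `|x|`, hence bounded by its
value at the end points. -/
lemma sonin_le (n : ℕ) {x : ℝ} (hx : x ∈ Icc (-1 : ℝ) 1) :
    (n : ℝ) * (n + 1) * (rodrigues n n).eval x ^ 2
        + (1 - x ^ 2) * (rodrigues n (n + 1)).eval x ^ 2 ≤
      n * (n + 1) * (2 ^ n * (n.factorial : ℝ)) ^ 2 := by
  set S : ℝ[X] := C ((n : ℝ) * (n + 1)) * rodrigues n n ^ 2 + wPoly * rodrigues n (n + 1) ^ 2
    with hS
  have hS' : derivative S = C 2 * X * rodrigues n (n + 1) ^ 2 := by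
    have h := rodrigues_ode n n
    simp only [hS, derivative_mul, derivative_add, derivative_pow, derivative_rodrigues,
      derivative_wPoly, derivative_C] at h ⊢
    simp [C_two_eq, wPoly, add_assoc] at h ⊢
    linear_combination -2 * rodrigues n (n + 1) * h
  have hev : ∀ y, S.eval y = (n : ℝ) * (n + 1) * (rodrigues n n).eval y ^ 2
        + (1 - y ^ 2) * (rodrigues n (n + 1)).eval y ^ 2 := fun y => by simp [hS]
  have hd : ∀ y, deriv (fun z => S.eval z) y = 2 * y * (rodrigues n (n + 1)).eval y ^ 2 :=
    fun y => by rw [Polynomial.deriv, hS']; simp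
  have hend : ∀ a : ℝ, a ^ 2 = 1 → S.eval a = n * (n + 1) * (2 ^ n * (n.factorial : ℝ)) ^ 2 := by
    intro a ha
    have : (a ^ n) ^ 2 = 1 := by rw [← pow_mul, mul_comm, pow_mul, ha, one_pow]
    rw [hev, eval_rodrigues_of_sq_eq_one n ha, ha, mul_pow, mul_pow, mul_pow, mul_pow, this]
    ring
  rw [← hev]
  rcases le_total 0 x with h0 | h0
  · have hm : MonotoneOn (fun z => S.eval z) (Icc 0 1) :=
      monotoneOn_of_deriv_nonneg (convex_Icc _ _) S.continuous.continuousOn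
        S.differentiable.differentiableOn fun y hy => by
          rw [interior_Icc] at hy
          have := hy.1
          rw [hd]
          positivity
    rw [← hend 1 (by norm_num)]
    exact hm ⟨h0, hx.2⟩ ⟨zero_le_one, le_rfl⟩ hx.2
  · have hm : AntitoneOn (fun z => S.eval z) (Icc (-1) 0) :=
      antitoneOn_of_deriv_nonpos (convex_Icc _ _) S.continuous.continuousOn
        S.differentiable.differentiableOn fun y hy => by
          rw [interior_Icc] at hy
          rw [hd]
          nlinarith [hy.2, sq_nonneg ((rodrigues n (n + 1)).eval y)]
    rw [← hend (-1) (by norm_num)]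
    exact hm ⟨le_rfl, by norm_num⟩ ⟨hx.1, h0⟩ hx.1

/-- The polynomial `e` with `Ỹ_{n,m} = (-1)^m (1 - x²)^(m/2) e` on `[-1, 1]`, for `0 ≤ m ≤ n`. -/
def sphPoly (n m : ℕ) : ℝ[X] :=
  C (√((2 * n + 1) / (4 * Real.pi) * ((n - m).factorial / (n + m).factorial))
    / (2 ^ n * n.factorial)) * rodrigues n (n + m)

lemma iteratedDeriv_eval (p : ℝ[X]) (k : ℕ) :
    iteratedDeriv k (fun x => p.eval x) = fun x => (derivative^[k] p).eval x := by
  induction k with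
  | zero => simp
  | succ k ih =>
    rw [iteratedDeriv_succ, ih, Function.iterate_succ_apply']
    funext x
    exact Polynomial.deriv _

lemma legendreP_eq (n : ℕ) :
    legendreP n = fun x => (C ((2 ^ n * (n.factorial : ℝ))⁻¹) * rodrigues n n).eval x := by
  funext x
  have h : (fun y : ℝ => (y ^ 2 - 1) ^ n) = fun y => ((X ^ 2 - 1 : ℝ[X]) ^ n).eval y := by
    funext y; simp
  simp only [legendreP, h, iteratedDeriv_eval, rodrigues, eval_mul, eval_C]

lemma assocP_eq (n m : ℕ) (x : ℝ) :
    assocP n m x = (-1) ^ m * √(1 - x ^ 2) ^ m *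
      ((2 ^ n * (n.factorial : ℝ))⁻¹ * (rodrigues n (n + m)).eval x) := by
  rw [assocP, legendreP_eq, iteratedDeriv_eval, iterate_derivative_C_mul, rodrigues,
    ← Function.iterate_add_apply, add_comm m n, rodrigues]
  simp

lemma tY_natCast (n m : ℕ) (x : ℝ) :
    tY n m x = (-1) ^ m * √(1 - x ^ 2) ^ m * (sphPoly n m).eval x := by
  have h1 : ((n : ℤ) - m).toNat = n - m := by omega
  have h2 : ((n : ℤ) + m).toNat = n + m := by omega
  rw [tY, assocPZ, if_pos (by positivity), Int.toNat_natCast, assocP_eq, h1, h2, sphPoly,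
    eval_mul, eval_C]
  ring

lemma tY_neg_natCast {n m : ℕ} (hm : m ≤ n) (x : ℝ) :
    tY n (-m) x = (-1) ^ m * tY n m x := by
  rcases Nat.eq_zero_or_pos m with rfl | h0
  · simp
  have h1 : ((n : ℤ) - m).toNat = n - m := by omega
  have h2 : ((n : ℤ) + m).toNat = n + m := by omega
  have h3 : ((n : ℤ) - -m).toNat = n + m := by omega
  have h4 : ((n : ℤ) + -m).toNat = n - m := by omega
  rw [tY, tY, assocPZ, assocPZ, if_neg (by omega), if_pos (by positivity), Int.toNat_natCast,
    h1, h2, h3, h4, Int.natAbs_neg, Int.natAbs_natCast]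
  have ha : (0 : ℝ) < (n - m).factorial := by positivity
  have hb : (0 : ℝ) < (n + m).factorial := by positivity
  have hc : (0 : ℝ) ≤ (2 * n + 1) / (4 * Real.pi) := by positivity
  have key : √((2 * (n : ℝ) + 1) / (4 * Real.pi) * ((n + m).factorial / (n - m).factorial)) *
      ((n - m).factorial / (n + m).factorial) =
      √((2 * (n : ℝ) + 1) / (4 * Real.pi) * ((n - m).factorial / (n + m).factorial)) := by
    rw [← Real.sqrt_sq (by positivity : (0 : ℝ) ≤ (n - m).factorial / (n + m).factorial),
      ← Real.sqrt_mul (by positivity), Real.sqrt_sq (by positivity)]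
    congr 1
    field_simp
  rw [← key]
  ring

lemma tY_sq {n : ℕ} {m : ℤ} (hm : m.natAbs ≤ n) (x : ℝ) :
    tY n m x ^ 2 = tY n m.natAbs x ^ 2 := by
  obtain ⟨k, rfl | rfl⟩ := m.eq_nat_or_neg
  · simp
  · rw [Int.natAbs_neg, Int.natAbs_natCast] at *
    rw [tY_neg_natCast hm, mul_pow, ← pow_mul, mul_comm k, pow_mul]
    norm_num

lemma tY_natCast_mul {x : ℝ} (hx : x ∈ Icc (-1 : ℝ) 1) (n n' m : ℕ) :
    tY n m x * tY n' m x =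
      (wPoly ^ m * sphPoly n m * sphPoly n' m).eval x := by
  have hw : 0 ≤ 1 - x ^ 2 := by nlinarith [hx.1, hx.2]
  have h1 : ((-1 : ℝ) ^ m) ^ 2 = 1 := by rw [← pow_mul, mul_comm, pow_mul]; norm_num
  have h2 : (√(1 - x ^ 2) ^ m) ^ 2 = (1 - x ^ 2) ^ m := by
    rw [← pow_mul, mul_comm, pow_mul, Real.sq_sqrt hw]
  rw [tY_natCast, tY_natCast]
  simp only [eval_mul, eval_pow, eval_wPoly]
  rw [← h2]
  linear_combination (√(1 - x ^ 2) ^ m) ^ 2 * eval x (sphPoly n m) * eval x (sphPoly n' m) * h1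

lemma polyInt_sphPoly_of_ne {n n' : ℕ} (m : ℕ) (h : n ≠ n') :
    polyInt (wPoly ^ m * sphPoly n m * sphPoly n' m) = 0 := by
  have := polyInt_rodrigues_of_ne (m := m) h
  rw [sphPoly, sphPoly, mul_left_comm, polyInt_C_mul, mul_left_comm (wPoly ^ m), mul_assoc,
    polyInt_C_mul, this]
  simp

lemma polyInt_sphPoly_sq {n m : ℕ} (h : m ≤ n) :
    polyInt (wPoly ^ m * sphPoly n m * sphPoly n m) = (2 * Real.pi)⁻¹ := by
  have h1 := polyInt_rodrigues_sq_mul_factorial h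
  have h2 := polyInt_rodrigues_sq n
  have ha : (0 : ℝ) < (n - m).factorial := by positivity
  have hb : (0 : ℝ) < (n + m).factorial := by positivity
  have hn : (0 : ℝ) < n.factorial := by positivity
  rw [sphPoly, mul_left_comm, polyInt_C_mul, mul_left_comm (wPoly ^ m), mul_assoc,
    polyInt_C_mul, mul_assoc (wPoly ^ m), ← sq, ← mul_assoc, div_mul_div_comm,
    Real.mul_self_sqrt (by positivity)]
  have h3 : polyInt (rodrigues n n ^ 2) = 2 * (2 ^ n * (n.factorial : ℝ)) ^ 2 / (2 * n + 1) := by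
    rw [eq_div_iff (by positivity)]; linarith
  rw [h3, ← eq_div_iff ha.ne'] at h1
  rw [h1]
  field_simp
  norm_num

lemma inv_four_pi_le_one : (4 * Real.pi)⁻¹ ≤ 1 :=
  inv_le_one_of_one_le₀ (by linarith [Real.two_le_pi])

lemma tY_zero_sq_le (n : ℕ) {x : ℝ} (hx : x ∈ Icc (-1 : ℝ) 1) :
    tY n (0 : ℕ) x ^ 2 ≤ 2 * n + 1 := by
  have hr : (rodrigues n n).eval x ^ 2 ≤ (2 ^ n * (n.factorial : ℝ)) ^ 2 := by
    rcases Nat.eq_zero_or_pos n with rfl | hn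
    · simp [rodrigues]
    · have hn' : (0 : ℝ) < n := by exact_mod_cast hn
      have hw : 0 ≤ 1 - x ^ 2 := by nlinarith [hx.1, hx.2]
      have h := sonin_le n hx
      have h' : 0 ≤ (1 - x ^ 2) * (rodrigues n (n + 1)).eval x ^ 2 := by positivity
      refine le_of_mul_le_mul_left ?_ (by positivity : (0 : ℝ) < n * (n + 1))
      linarith
  have hn0 : (0 : ℝ) < n.factorial := by positivity
  rw [tY_natCast, sphPoly, eval_mul, eval_C]
  simp only [Nat.sub_zero, Nat.add_zero, pow_zero, one_mul]
  rw [mul_pow, div_pow, Real.sq_sqrt (by positivity), div_self hn0.ne', mul_one,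
    div_mul_eq_mul_div]
  refine div_le_of_le_mul₀ (by positivity) (by positivity) ?_
  refine mul_le_mul ?_ hr (sq_nonneg _) (by positivity)
  rw [div_eq_mul_inv]
  exact mul_le_of_le_one_right (by positivity) inv_four_pi_le_one

lemma tY_one_sq_le {n : ℕ} (hn : 1 ≤ n) {x : ℝ} (hx : x ∈ Icc (-1 : ℝ) 1) :
    tY n (1 : ℕ) x ^ 2 ≤ 2 * n + 1 := by
  obtain ⟨k, rfl⟩ := Nat.exists_eq_add_of_le' hn
  have hw : 0 ≤ 1 - x ^ 2 := by nlinarith [hx.1, hx.2]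
  set n := k + 1
  have hr : (1 - x ^ 2) * (rodrigues n (n + 1)).eval x ^ 2 ≤
      n * (n + 1) * (2 ^ n * (n.factorial : ℝ)) ^ 2 := by
    have h := sonin_le n hx
    have h' : 0 ≤ (n : ℝ) * (n + 1) * (rodrigues n n).eval x ^ 2 := by positivity
    linarith
  have hk0 : (0 : ℝ) < k.factorial := by positivity
  have hf : ((n + 1).factorial : ℝ) = (n + 1) * (n * k.factorial) := by
    simp only [n, Nat.factorial_succ]; push_cast; ring
  have hn0 : (0 : ℝ) < n := by positivity
  rw [sq, tY_natCast_mul hx]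
  simp only [sphPoly, eval_mul, eval_C, eval_wPoly, pow_one]
  have hs : √((2 * (n : ℝ) + 1) / (4 * Real.pi) * ((n - 1).factorial / (n + 1).factorial)) ^ 2 =
      (2 * n + 1) * (4 * Real.pi)⁻¹ / (n * (n + 1)) := by
    rw [Real.sq_sqrt (by positivity), hf, show n - 1 = k from rfl]
    field_simp
  generalize √((2 * (n : ℝ) + 1) / (4 * Real.pi) * ((n - 1).factorial / (n + 1).factorial)) = s
    at hs ⊢
  have hd : (0 : ℝ) < 2 ^ n * (n.factorial : ℝ) := by positivity
  generalize (2 : ℝ) ^ n * (n.factorial : ℝ) = d at hd hr ⊢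
  calc _ = s ^ 2 / d ^ 2 * ((1 - x ^ 2) * (rodrigues n (n + 1)).eval x ^ 2) := by ring
    _ ≤ s ^ 2 / d ^ 2 * (n * (n + 1) * d ^ 2) := by gcongr
    _ = (2 * n + 1) * (4 * Real.pi)⁻¹ := by rw [hs]; field_simp
    _ ≤ 2 * n + 1 := mul_le_of_le_one_right (by positivity) inv_four_pi_le_one

lemma grushinOp_C_mul (m : ℕ) (c : ℝ) (q : ℝ[X]) : grushinOp m (C c * q) = C c * grushinOp m q := by
  simp only [grushinOp, derivative_C_mul]
  ring

lemma grushinOp_sum (m : ℕ) {ι : Type*} (s : Finset ι) (f : ι → ℝ[X]) :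
    grushinOp m (∑ i ∈ s, f i) = ∑ i ∈ s, grushinOp m (f i) := by
  simp only [grushinOp, derivative_sum, Finset.mul_sum, Finset.sum_add_distrib,
    Finset.sum_neg_distrib]

lemma grushinOp_sphPoly (n m : ℕ) :
    grushinOp m (sphPoly n m) = C (eigenL n m) * sphPoly n m := by
  rw [sphPoly, grushinOp_C_mul, grushinOp_rodrigues, mul_left_comm]
  simp [eigenL]

lemma grushinOp_sum_sphPoly (m : ℕ) (s : Finset ℕ) (b : ℕ → ℝ) :
    grushinOp m (∑ n ∈ s, C (b n) * sphPoly n m) =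
      ∑ n ∈ s, C (b n * eigenL n m) * sphPoly n m := by
  rw [grushinOp_sum]
  refine Finset.sum_congr rfl fun n _ => ?_
  rw [grushinOp_C_mul, grushinOp_sphPoly, C_mul, mul_assoc]

lemma polyInt_sum_mul_sum {m : ℕ} {s : Finset ℕ} (hs : ∀ n ∈ s, m ≤ n) (a b : ℕ → ℝ) :
    polyInt (wPoly ^ m * (∑ n ∈ s, C (a n) * sphPoly n m) * (∑ n ∈ s, C (b n) * sphPoly n m)) =
      (2 * Real.pi)⁻¹ * ∑ n ∈ s, a n * b n := by
  rw [mul_assoc, Finset.sum_mul_sum, Finset.mul_sum, polyInt_sum, Finset.mul_sum]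
  refine Finset.sum_congr rfl fun n hn => ?_
  rw [Finset.mul_sum, polyInt_sum, Finset.sum_eq_single_of_mem n hn]
  · rw [← polyInt_sphPoly_sq (hs n hn), mul_comm (polyInt _), ← polyInt_C_mul, C_mul]
    congr 1
    ring
  · intro n' _ hne
    have h := polyInt_sphPoly_of_ne m hne.symm
    rw [show wPoly ^ m * (C (a n) * sphPoly n m * (C (b n') * sphPoly n' m)) =
      C (a n * b n') * (wPoly ^ m * sphPoly n m * sphPoly n' m) by rw [C_mul]; ring,
      polyInt_C_mul, h, mul_zero]

lemma one_sub_sq_nonneg {x : ℝ} (hx : x ∈ Icc (-1 : ℝ) 1) : 0 ≤ 1 - x ^ 2 := by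
  nlinarith [hx.1, hx.2]

lemma one_sub_sq_pos {x : ℝ} (hx : x ∈ Ioo (-1 : ℝ) 1) : 0 < 1 - x ^ 2 := by
  nlinarith [hx.1, hx.2]

lemma hasDerivAt_sqrt_one_sub_sq {x : ℝ} (hx : x ∈ Ioo (-1 : ℝ) 1) :
    HasDerivAt (fun y : ℝ => √(1 - y ^ 2)) (-x / √(1 - x ^ 2)) x := by
  have h := (((hasDerivAt_id x).pow 2).const_sub 1).sqrt (one_sub_sq_pos hx).ne'
  refine (h.congr_deriv ?_)
  simp
  ring

lemma hasDerivAt_one_sub_sq_pow (k : ℕ) (x : ℝ) :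
    HasDerivAt (fun y : ℝ => (1 - y ^ 2) ^ (k + 1)) (-(2 * (k + 1) * x * (1 - x ^ 2) ^ k)) x := by
  have h := (((hasDerivAt_id x).pow 2).const_sub 1).pow (k + 1)
  refine (h.congr_deriv ?_)
  simp
  ring

lemma two_mul_mul_le_of_pos {τ : ℝ} (hτ : 0 < τ) (a b : ℝ) : 2 * (a * b) ≤ a ^ 2 / τ + τ * b ^ 2 := by
  have h : 0 ≤ (a - τ * b) ^ 2 / τ := by positivity
  have e : (a - τ * b) ^ 2 / τ = a ^ 2 / τ + τ * b ^ 2 - 2 * (a * b) := by field_simp; ring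
  linarith

/-- A weighted Sobolev-type pointwise bound. -/
lemma pointwise_bound_energy (k : ℕ) (q : ℝ[X]) {τ : ℝ} (hτ : 0 < τ) {x : ℝ}
    (hx : x ∈ Icc (-1 : ℝ) 1) :
    √(1 - x ^ 2) * (1 - x ^ 2) ^ (k + 1) * q.eval x ^ 2 ≤
      5 / 2 * (polyInt (wPoly ^ (k + 1) * q ^ 2) / τ
        + τ * (polyInt (wPoly ^ (k + 2) * derivative q ^ 2)
          + ((k : ℝ) + 1) * polyInt (wPoly ^ (k + 1) * q ^ 2))) := by
  have hE := potential_le_energy q k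
  have hD : 0 ≤ polyInt (wPoly ^ (k + 2) * derivative q ^ 2) := polyInt_nonneg fun y hy => by
    have := one_sub_sq_nonneg hy
    simp only [eval_mul, eval_pow, eval_wPoly]
    positivity
  have hN : 0 ≤ polyInt (wPoly ^ (k + 1) * q ^ 2) := polyInt_nonneg fun y hy => by
    have := one_sub_sq_nonneg hy
    simp only [eval_mul, eval_pow, eval_wPoly]
    positivity
  set B : ℝ[X] := C (5 / 2 / τ) * (wPoly ^ (k + 1) * q ^ 2)
    + C τ * (wPoly ^ (k + 2) * derivative q ^ 2)
    + C (3 / 2 * τ * ((k : ℝ) + 1) ^ 2) * (X ^ 2 * wPoly ^ k * q ^ 2) with hB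
  have hmain : √(1 - x ^ 2) * (1 - x ^ 2) ^ (k + 1) * q.eval x ^ 2 ≤ polyInt B := by
    refine le_polyInt_of_deriv_le
      (F := fun y => √(1 - y ^ 2) * (1 - y ^ 2) ^ (k + 1) * q.eval y ^ 2)
      (by fun_prop) (by simp) (fun y hy => ((hasDerivAt_sqrt_one_sub_sq hy).mul
        (hasDerivAt_one_sub_sq_pow k y)).mul ((q.hasDerivAt y).pow 2)) ?_ ?_ hx
    · intro y hy
      have hw := one_sub_sq_pos hy
      set s := √(1 - y ^ 2) with hs
      have hs0 : 0 < s := Real.sqrt_pos.2 hw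
      have hs2 : 1 - y ^ 2 = s ^ 2 := (Real.sq_sqrt hw.le).symm
      simp only [Pi.mul_apply, Pi.pow_apply, ← hs]
      simp only [hB, eval_add, eval_mul, eval_C, eval_pow, eval_wPoly, eval_X, Nat.cast_ofNat,
        Nat.add_one_sub_one, pow_one, hs2]
      have h1 := two_mul_mul_le_of_pos hτ (s ^ (k + 1) * q.eval y)
        (s ^ (k + 2) * (derivative q).eval y)
      have h2 := two_mul_mul_le_of_pos hτ (s ^ (k + 1) * q.eval y)
        (-(((k : ℝ) + 1) * y * s ^ k * q.eval y))
      have hk : (0 : ℝ) ≤ k := Nat.cast_nonneg k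
      have h4 := two_mul_mul_le_of_pos hτ (s ^ (k + 1) * q.eval y) (-(y * s ^ k * q.eval y))
      have h5 : τ * (-(y * s ^ k * q.eval y)) ^ 2 ≤
          τ * (-(((k : ℝ) + 1) * y * s ^ k * q.eval y)) ^ 2 := by
        have : (-(((k : ℝ) + 1) * y * s ^ k * q.eval y)) ^ 2 =
          ((k : ℝ) + 1) ^ 2 * (-(y * s ^ k * q.eval y)) ^ 2 := by ring
        rw [this]
        refine mul_le_mul_of_nonneg_left (le_mul_of_one_le_left (sq_nonneg _) ?_) hτ.le
        nlinarith
      have e : (-y / s * (s ^ 2) ^ (k + 1) + s * -(2 * (k + 1) * y * (s ^ 2) ^ k)) * q.eval y ^ 2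
          + s * (s ^ 2) ^ (k + 1) * (2 * q.eval y * (derivative q).eval y) =
          2 * (s ^ (k + 1) * q.eval y * (s ^ (k + 2) * (derivative q).eval y))
          + 2 * (s ^ (k + 1) * q.eval y * (-(((k : ℝ) + 1) * y * s ^ k * q.eval y)))
          + s ^ (k + 1) * q.eval y * (-(y * s ^ k * q.eval y)) := by
        field_simp
        ring
      rw [e]
      have e2 : 5 / 2 / τ * ((s ^ 2) ^ (k + 1) * q.eval y ^ 2) =
        5 / 2 * ((s ^ (k + 1) * q.eval y) ^ 2 / τ) := by ring
      rw [e2]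
      have e3 : τ * ((s ^ 2) ^ (k + 2) * (derivative q).eval y ^ 2) =
        τ * (s ^ (k + 2) * (derivative q).eval y) ^ 2 := by ring
      rw [e3]
      have e4 : 3 / 2 * τ * ((k : ℝ) + 1) ^ 2 * (y ^ 2 * (s ^ 2) ^ k * q.eval y ^ 2) =
        3 / 2 * (τ * (-(((k : ℝ) + 1) * y * s ^ k * q.eval y)) ^ 2) := by ring
      rw [e4]
      linarith
    · intro y hy
      have := one_sub_sq_nonneg hy
      simp only [hB, eval_add, eval_mul, eval_C, eval_pow, eval_wPoly, eval_X]
      positivity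
  refine hmain.trans ?_
  rw [hB, polyInt_add, polyInt_add, polyInt_C_mul, polyInt_C_mul, polyInt_C_mul]
  have h1 := mul_le_mul_of_nonneg_left hE hτ.le
  have h2 : 0 ≤ τ * (((k : ℝ) + 1) * polyInt (wPoly ^ (k + 1) * q ^ 2)) := by positivity
  calc _ = 5 / 2 * (polyInt (wPoly ^ (k + 1) * q ^ 2) / τ)
        + τ * polyInt (wPoly ^ (k + 2) * derivative q ^ 2)
        + 3 / 2 * (τ * (((k : ℝ) + 1) ^ 2 * polyInt (X ^ 2 * wPoly ^ k * q ^ 2))) := by ring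
    _ ≤ _ := by linarith

/-- A weighted Sobolev-type pointwise bound involving the potential. -/
lemma pointwise_bound_potential (k : ℕ) (q : ℝ[X]) {τ : ℝ} (hτ : 0 < τ) {x : ℝ}
    (hx : x ∈ Icc (-1 : ℝ) 1) :
    ((k : ℝ) + 2) ^ 2 * x ^ 2 * (√(1 - x ^ 2) * (1 - x ^ 2) ^ (k + 1) * q.eval x ^ 2) ≤
      τ * (((k : ℝ) + 2) ^ 2 * polyInt (wPoly ^ (k + 2) * q ^ 2)
          + 2 * (((k : ℝ) + 2) ^ 4 * polyInt (X ^ 4 * wPoly ^ k * q ^ 2)))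
        + (2 * (((k : ℝ) + 2) ^ 2 * polyInt (X ^ 2 * wPoly ^ (k + 1) * q ^ 2))
          + polyInt (wPoly ^ (k + 3) * derivative q ^ 2)) / τ := by
  have hk : (0 : ℝ) ≤ k := Nat.cast_nonneg k
  set m : ℝ := (k : ℝ) + 2 with hm
  set B : ℝ[X] := C (τ * m ^ 2) * (wPoly ^ (k + 2) * q ^ 2)
    + C (2 * τ * m ^ 4) * (X ^ 4 * wPoly ^ k * q ^ 2)
    + C (2 / τ * m ^ 2) * (X ^ 2 * wPoly ^ (k + 1) * q ^ 2)
    + C (1 / τ) * (wPoly ^ (k + 3) * derivative q ^ 2) with hB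
  have hmain : m ^ 2 * x ^ 2 * (√(1 - x ^ 2) * (1 - x ^ 2) ^ (k + 1) * q.eval x ^ 2) ≤
      polyInt B := by
    refine le_polyInt_of_deriv_le
      (F := fun y => m ^ 2 * y ^ 2 * (√(1 - y ^ 2) * (1 - y ^ 2) ^ (k + 1) * q.eval y ^ 2))
      (by fun_prop) (by simp) (fun y hy => ((hasDerivAt_pow 2 y).const_mul (m ^ 2)).mul
        (((hasDerivAt_sqrt_one_sub_sq hy).mul
        (hasDerivAt_one_sub_sq_pow k y)).mul ((q.hasDerivAt y).pow 2))) ?_ ?_ hx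
    · intro y hy
      have hw := one_sub_sq_pos hy
      set s := √(1 - y ^ 2) with hs
      have hs0 : 0 < s := Real.sqrt_pos.2 hw
      have hs2 : 1 - y ^ 2 = s ^ 2 := (Real.sq_sqrt hw.le).symm
      simp only [Pi.mul_apply, Pi.pow_apply, ← hs]
      simp only [hB, eval_add, eval_mul, eval_C, eval_pow, eval_wPoly, eval_X, Nat.cast_ofNat,
        Nat.add_one_sub_one, pow_one, hs2]
      have h1 := two_mul_mul_le_of_pos hτ (m * y * s ^ (k + 1) * q.eval y)
        (m * (s ^ (k + 2) * q.eval y))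
      have h2 := two_mul_mul_le_of_pos hτ (m * y * s ^ (k + 1) * q.eval y)
        (-(m ^ 2 * y ^ 2 * s ^ k * q.eval y))
      have h3 := two_mul_mul_le_of_pos hτ (s ^ (k + 3) * (derivative q).eval y)
        (m ^ 2 * y ^ 2 * s ^ k * q.eval y)
      have h4 : -(m ^ 2 * y ^ 3 * (2 * m - 1) * (s ^ (2 * k + 1) * q.eval y ^ 2)) ≤
          (m * y * s ^ (k + 1) * q.eval y) ^ 2 / τ
            + τ * (-(m ^ 2 * y ^ 2 * s ^ k * q.eval y)) ^ 2 := by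
        by_cases hy0 : 0 ≤ y
        · refine le_trans (neg_nonpos.2 ?_) (by positivity)
          have : 0 ≤ 2 * m - 1 := by linarith
          positivity
        · refine le_trans ?_ h2
          have h5 : 0 ≤ m ^ 2 * (-y) ^ 3 * (s ^ (2 * k + 1) * q.eval y ^ 2) := by
            have : 0 ≤ -y := by linarith
            positivity
          have e : 2 * (m * y * s ^ (k + 1) * q.eval y * -(m ^ 2 * y ^ 2 * s ^ k * q.eval y)) =
            2 * m * (m ^ 2 * (-y) ^ 3 * (s ^ (2 * k + 1) * q.eval y ^ 2)) := by ring
          rw [e]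
          nlinarith
      have e : m ^ 2 * (2 * y) * (s * (s ^ 2) ^ (k + 1) * q.eval y ^ 2) + m ^ 2 * y ^ 2 *
          ((-y / s * (s ^ 2) ^ (k + 1) + s * -(2 * (k + 1) * y * (s ^ 2) ^ k)) * q.eval y ^ 2
          + s * (s ^ 2) ^ (k + 1) * (2 * q.eval y * (derivative q).eval y)) =
          2 * (m * y * s ^ (k + 1) * q.eval y * (m * (s ^ (k + 2) * q.eval y)))
          + -(m ^ 2 * y ^ 3 * (2 * m - 1) * (s ^ (2 * k + 1) * q.eval y ^ 2))
          + 2 * (s ^ (k + 3) * (derivative q).eval y * (m ^ 2 * y ^ 2 * s ^ k * q.eval y)) := by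
        have : (k : ℝ) = m - 2 := by rw [hm]; ring
        rw [this]
        field_simp
        ring
      rw [e]
      have e2 : τ * m ^ 2 * ((s ^ 2) ^ (k + 2) * q.eval y ^ 2)
        + 2 * τ * m ^ 4 * (y ^ 4 * (s ^ 2) ^ k * q.eval y ^ 2)
        + 2 / τ * m ^ 2 * (y ^ 2 * (s ^ 2) ^ (k + 1) * q.eval y ^ 2)
        + 1 / τ * ((s ^ 2) ^ (k + 3) * (derivative q).eval y ^ 2) =
        τ * (m * (s ^ (k + 2) * q.eval y)) ^ 2
        + (τ * (-(m ^ 2 * y ^ 2 * s ^ k * q.eval y)) ^ 2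
          + τ * (m ^ 2 * y ^ 2 * s ^ k * q.eval y) ^ 2)
        + 2 * ((m * y * s ^ (k + 1) * q.eval y) ^ 2 / τ)
        + (s ^ (k + 3) * (derivative q).eval y) ^ 2 / τ := by ring
      rw [e2]
      linarith
    · intro y hy
      have := one_sub_sq_nonneg hy
      simp only [hB, eval_add, eval_mul, eval_C, eval_pow, eval_wPoly, eval_X]
      positivity
  refine hmain.trans (le_of_eq ?_)
  rw [hB, polyInt_add, polyInt_add, polyInt_add, polyInt_C_mul, polyInt_C_mul, polyInt_C_mul,
    polyInt_C_mul]
  ring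

lemma natCast_le_eigenL {n m : ℕ} (h : m ≤ n) : (m : ℝ) ≤ eigenL n m := by
  have h' : (m : ℝ) ≤ n := by exact_mod_cast h
  have h0 : (0 : ℝ) ≤ m := Nat.cast_nonneg m
  simp only [eigenL, Int.cast_natCast]
  nlinarith

lemma mul_exp_neg_le {r : ℝ} (hr : 0 < r) (a : ℝ) :
    a * Real.exp (-(2 * r ^ 2 * a)) ≤ 1 / (2 * r ^ 2) := by
  have h := Real.add_one_le_exp (2 * r ^ 2 * a)
  rw [Real.exp_neg, ← div_eq_mul_inv, div_le_div_iff₀ (Real.exp_pos _) (by positivity)]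
  linarith

lemma sq_mul_exp_neg_le {r a : ℝ} (hr : 0 < r) (ha : 0 ≤ a) :
    a ^ 2 * Real.exp (-(2 * r ^ 2 * a)) ≤ 1 / r ^ 4 := by
  have h := Real.add_one_le_exp (r ^ 2 * a)
  have h2 : (r ^ 2 * a) ^ 2 ≤ Real.exp (r ^ 2 * a) ^ 2 :=
    pow_le_pow_left₀ (by positivity) (by linarith) 2
  rw [← Real.exp_nat_mul] at h2
  rw [Real.exp_neg, ← div_eq_mul_inv, div_le_div_iff₀ (Real.exp_pos _) (by positivity)]
  push_cast at h2
  rw [← mul_assoc] at h2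
  calc a ^ 2 * r ^ 4 = (r ^ 2 * a) ^ 2 := by ring
    _ ≤ _ := by rw [one_mul]; exact h2

/-- The part of the diagonal of the (truncated) heat kernel at time `2 r ^ 2` which comes from a
given angular frequency. -/
def heatDiag (r : ℝ) (N m : ℕ) (x : ℝ) : ℝ :=
  ∑ n ∈ (Finset.range (N + 1)).filter (m ≤ ·), Real.exp (-(2 * r ^ 2 * eigenL n m)) * tY n m x ^ 2

lemma heatDiag_nonneg (r : ℝ) (N m : ℕ) (x : ℝ) : 0 ≤ heatDiag r N m x :=
  Finset.sum_nonneg fun _ _ => by positivity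

/-- The polynomial `q` for which `x ↦ (1 - x ^ 2) ^ m * q x` represents the heat kernel. -/
def heatPoly (r : ℝ) (N m : ℕ) (x : ℝ) : ℝ[X] :=
  ∑ n ∈ (Finset.range (N + 1)).filter (m ≤ ·),
    C (Real.exp (-(2 * r ^ 2 * eigenL n m)) * (sphPoly n m).eval x) * sphPoly n m

lemma eval_heatPoly (r : ℝ) (N m : ℕ) (x : ℝ) :
    (heatPoly r N m x).eval x = ∑ n ∈ (Finset.range (N + 1)).filter (m ≤ ·),
      Real.exp (-(2 * r ^ 2 * eigenL n m)) * (sphPoly n m).eval x ^ 2 := by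
  simp only [heatPoly, eval_finsetSum, eval_mul, eval_C]
  exact Finset.sum_congr rfl fun n _ => by ring

lemma heatDiag_eq (r : ℝ) (N m : ℕ) {x : ℝ} (hx : x ∈ Icc (-1 : ℝ) 1) :
    heatDiag r N m x = (1 - x ^ 2) ^ m * (heatPoly r N m x).eval x := by
  rw [eval_heatPoly, heatDiag, Finset.mul_sum]
  refine Finset.sum_congr rfl fun n _ => ?_
  rw [sq (tY n m x), tY_natCast_mul hx]
  simp only [eval_mul, eval_pow, eval_wPoly]
  ring

lemma inv_two_pi_le_one : (2 * Real.pi)⁻¹ ≤ 1 :=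
  inv_le_one_of_one_le₀ (by linarith [Real.pi_gt_three])

lemma heatPoly_sum_le {r c : ℝ} (N m : ℕ) (x : ℝ) (f : ℝ → ℝ)
    (hf : ∀ a : ℝ, 0 ≤ a → 0 ≤ f a ∧ f a * Real.exp (-(2 * r ^ 2 * a)) ≤ c) :
    (2 * Real.pi)⁻¹ * ∑ n ∈ (Finset.range (N + 1)).filter (m ≤ ·),
      f (eigenL n m) * (Real.exp (-(2 * r ^ 2 * eigenL n m)) * (sphPoly n m).eval x) ^ 2 ≤
      c * (heatPoly r N m x).eval x := by
  have hl : ∀ n ∈ (Finset.range (N + 1)).filter (m ≤ ·), 0 ≤ eigenL n m := fun n hn =>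
    (Nat.cast_nonneg m).trans (natCast_le_eigenL (Finset.mem_filter.1 hn).2)
  refine (mul_le_of_le_one_left (Finset.sum_nonneg fun n hn => ?_) inv_two_pi_le_one).trans ?_
  · exact mul_nonneg (hf _ (hl n hn)).1 (sq_nonneg _)
  · rw [eval_heatPoly, Finset.mul_sum]
    refine Finset.sum_le_sum fun n hn => ?_
    have h := (hf _ (hl n hn)).2
    have h2 : 0 ≤ Real.exp (-(2 * r ^ 2 * eigenL n m)) * (sphPoly n m).eval x ^ 2 := by positivity
    calc _ = f (eigenL n m) * Real.exp (-(2 * r ^ 2 * eigenL n m)) *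
          (Real.exp (-(2 * r ^ 2 * eigenL n m)) * (sphPoly n m).eval x ^ 2) := by ring
      _ ≤ _ := mul_le_mul_of_nonneg_right h h2

lemma heatPoly_mass_eq (r : ℝ) (N m : ℕ) (x : ℝ) :
    polyInt (wPoly ^ m * heatPoly r N m x ^ 2) =
      (2 * Real.pi)⁻¹ * ∑ n ∈ (Finset.range (N + 1)).filter (m ≤ ·),
        (Real.exp (-(2 * r ^ 2 * eigenL n m)) * (sphPoly n m).eval x) ^ 2 := by
  rw [sq, ← mul_assoc, heatPoly, polyInt_sum_mul_sum fun n hn => (Finset.mem_filter.1 hn).2]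
  simp only [sq]

lemma heatPoly_energy_eq (r : ℝ) (N m : ℕ) (x : ℝ) :
    polyInt (wPoly ^ (m + 1) * derivative (heatPoly r N m x) ^ 2)
        + m * polyInt (wPoly ^ m * heatPoly r N m x ^ 2) =
      (2 * Real.pi)⁻¹ * ∑ n ∈ (Finset.range (N + 1)).filter (m ≤ ·),
        eigenL n m * (Real.exp (-(2 * r ^ 2 * eigenL n m)) * (sphPoly n m).eval x) ^ 2 := by
  rw [sq, sq, ← mul_assoc, ← mul_assoc, ← polyInt_grushinOp]
  nth_rewrite 2 [heatPoly]
  rw [grushinOp_sum_sphPoly, heatPoly,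
    polyInt_sum_mul_sum fun n hn => (Finset.mem_filter.1 hn).2]
  congr 1
  exact Finset.sum_congr rfl fun n _ => by ring

lemma heatPoly_grushinOp_eq (r : ℝ) (N m : ℕ) (x : ℝ) :
    polyInt (wPoly ^ m * grushinOp m (heatPoly r N m x) ^ 2) =
      (2 * Real.pi)⁻¹ * ∑ n ∈ (Finset.range (N + 1)).filter (m ≤ ·),
        eigenL n m ^ 2 *
          (Real.exp (-(2 * r ^ 2 * eigenL n m)) * (sphPoly n m).eval x) ^ 2 := by
  rw [sq, ← mul_assoc, heatPoly, grushinOp_sum_sphPoly,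
    polyInt_sum_mul_sum fun n hn => (Finset.mem_filter.1 hn).2]
  congr 1
  exact Finset.sum_congr rfl fun n _ => by ring

lemma heatPoly_mass_le (r : ℝ) (N m : ℕ) (x : ℝ) :
    polyInt (wPoly ^ m * heatPoly r N m x ^ 2) ≤ (heatPoly r N m x).eval x := by
  have h := heatPoly_sum_le (r := r) (c := 1) N m x (fun _ => 1) fun a ha =>
    ⟨zero_le_one, by rw [one_mul, Real.exp_le_one_iff]; nlinarith [sq_nonneg r]⟩
  simpa only [one_mul, ← heatPoly_mass_eq] using h

lemma heatPoly_energy_le {r : ℝ} (hr : 0 < r) (N m : ℕ) (x : ℝ) :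
    polyInt (wPoly ^ (m + 1) * derivative (heatPoly r N m x) ^ 2)
        + m * polyInt (wPoly ^ m * heatPoly r N m x ^ 2) ≤
      1 / (2 * r ^ 2) * (heatPoly r N m x).eval x := by
  rw [heatPoly_energy_eq]
  exact heatPoly_sum_le N m x (fun a => a) fun a ha => ⟨ha, mul_exp_neg_le hr a⟩

lemma heatPoly_grushinOp_le {r : ℝ} (hr : 0 < r) (N m : ℕ) (x : ℝ) :
    polyInt (wPoly ^ m * grushinOp m (heatPoly r N m x) ^ 2) ≤
      1 / r ^ 4 * (heatPoly r N m x).eval x := by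
  rw [heatPoly_grushinOp_eq]
  exact heatPoly_sum_le N m x (fun a => a ^ 2) fun a ha => ⟨sq_nonneg a, sq_mul_exp_neg_le hr ha⟩

lemma heatPoly_energy_le_grushinOp (r : ℝ) (N m : ℕ) (x : ℝ) :
    m * (polyInt (wPoly ^ (m + 1) * derivative (heatPoly r N m x) ^ 2)
        + m * polyInt (wPoly ^ m * heatPoly r N m x ^ 2)) ≤
      polyInt (wPoly ^ m * grushinOp m (heatPoly r N m x) ^ 2) := by
  rw [heatPoly_energy_eq, heatPoly_grushinOp_eq, mul_left_comm, Finset.mul_sum]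
  refine mul_le_mul_of_nonneg_left (Finset.sum_le_sum fun n hn => ?_) (by positivity)
  have h := natCast_le_eigenL (Finset.mem_filter.1 hn).2
  have h0 : (0 : ℝ) ≤ m := Nat.cast_nonneg m
  rw [← mul_assoc]
  refine mul_le_mul_of_nonneg_right ?_ (sq_nonneg _)
  nlinarith

lemma polyInt_wPoly_pow_mul_sq_nonneg (m : ℕ) (q : ℝ[X]) : 0 ≤ polyInt (wPoly ^ m * q ^ 2) :=
  polyInt_nonneg fun y hy => by
    have := one_sub_sq_nonneg hy
    simp only [eval_mul, eval_pow, eval_wPoly]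
    positivity

lemma eval_heatPoly_nonneg (r : ℝ) (N m : ℕ) (x : ℝ) : 0 ≤ (heatPoly r N m x).eval x := by
  rw [eval_heatPoly]
  exact Finset.sum_nonneg fun _ _ => by positivity

lemma sqrt_mul_heatDiag_le {r : ℝ} (hr : 0 < r) (N k : ℕ) {x : ℝ} (hx : x ∈ Icc (-1 : ℝ) 1) :
    √(1 - x ^ 2) * heatDiag r N (k + 1) x ≤ 4 / r := by
  rw [heatDiag_eq r N _ hx]
  have h1 := pointwise_bound_energy k (heatPoly r N (k + 1) x) hr hx
  have h2 := heatPoly_mass_le r N (k + 1) x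
  have h3 := heatPoly_energy_le hr N (k + 1) x
  have h0 := eval_heatPoly_nonneg r N (k + 1) x
  push_cast at h3
  set h := (heatPoly r N (k + 1) x).eval x
  rcases h0.eq_or_lt with h0 | h0
  · rw [← h0]
    simp only [mul_zero]
    positivity
  refine le_of_mul_le_mul_right ?_ h0
  calc √(1 - x ^ 2) * ((1 - x ^ 2) ^ (k + 1) * h) * h
      = √(1 - x ^ 2) * (1 - x ^ 2) ^ (k + 1) * h ^ 2 := by ring
    _ ≤ _ := h1
    _ ≤ 5 / 2 * (h / r + r * (1 / (2 * r ^ 2) * h)) := by gcongr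
    _ = 15 / 4 * (h / r) := by field_simp; ring
    _ ≤ 4 * (h / r) := by gcongr; norm_num
    _ = _ := by ring

lemma sq_mul_heatDiag_le {r : ℝ} (hr : 0 < r) (N k : ℕ) {x : ℝ} (hx : x ∈ Icc (-1 : ℝ) 1) :
    ((k : ℝ) + 2) ^ 2 * x ^ 2 * heatDiag r N (k + 2) x ≤ 91 * √(1 - x ^ 2) / r ^ 3 := by
  rw [heatDiag_eq r N _ hx]
  have h1 := pointwise_bound_potential k (heatPoly r N (k + 2) x) hr hx
  have h2 := sq_potential_le k (heatPoly r N (k + 2) x)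
  have h3 := heatPoly_energy_le hr N (k + 2) x
  have h4 := heatPoly_grushinOp_le hr N (k + 2) x
  have h5 := heatPoly_energy_le_grushinOp r N (k + 2) x
  have h6 := potential_le_energy (heatPoly r N (k + 2) x) (k + 1)
  have h7 := polyInt_wPoly_pow_mul_sq_nonneg (k + 2 + 1) (derivative (heatPoly r N (k + 2) x))
  have h8 := polyInt_wPoly_pow_mul_sq_nonneg (k + 2) (heatPoly r N (k + 2) x)
  have h0 := eval_heatPoly_nonneg r N (k + 2) x
  have hk : (0 : ℝ) ≤ k := Nat.cast_nonneg k
  have hs : √(1 - x ^ 2) ^ 2 = 1 - x ^ 2 := Real.sq_sqrt (one_sub_sq_nonneg hx)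
  rw [show k + 1 + 2 = k + 3 by ring, show k + 1 + 1 = k + 2 by ring] at h6
  rw [show k + 2 + 1 = k + 3 by ring] at h3 h5 h7
  push_cast at h3 h5 h6
  rw [show (k : ℝ) + 1 + 1 = k + 2 by ring] at h6
  set h := (heatPoly r N (k + 2) x).eval x
  set m : ℝ := (k : ℝ) + 2
  set s := √(1 - x ^ 2)
  set D := polyInt (wPoly ^ (k + 3) * derivative (heatPoly r N (k + 2) x) ^ 2)
  set M := polyInt (wPoly ^ (k + 2) * heatPoly r N (k + 2) x ^ 2)
  set G := polyInt (wPoly ^ (k + 2) * grushinOp (k + 2) (heatPoly r N (k + 2) x) ^ 2)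
  set V := polyInt (X ^ 2 * wPoly ^ (k + 1) * heatPoly r N (k + 2) x ^ 2)
  set Q := polyInt (X ^ 4 * wPoly ^ k * heatPoly r N (k + 2) x ^ 2)
  have hm : 2 ≤ m := by simp only [m]; linarith
  have hM : m ^ 2 * M ≤ G := by nlinarith
  have hE : D + m * M ≤ G := by nlinarith [mul_nonneg (by linarith : 0 ≤ m) h8]
  have hV : m * (m ^ 2 * V) ≤ G := (mul_le_mul_of_nonneg_left h6 (by linarith)).trans h5
  have hQ : m ^ 4 * Q ≤ 44 * G := by linarith
  have hD : D ≤ D + m * M := by nlinarith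
  rcases h0.eq_or_lt with h0 | h0
  · rw [← h0]
    simp only [mul_zero]
    positivity
  refine le_of_mul_le_mul_right ?_ h0
  calc m ^ 2 * x ^ 2 * ((1 - x ^ 2) ^ (k + 2) * h) * h
      = s * (m ^ 2 * x ^ 2 * (s * (1 - x ^ 2) ^ (k + 1) * h ^ 2)) := by
        rw [← hs]; ring
    _ ≤ s * (r * (m ^ 2 * M + 2 * (m ^ 4 * Q)) + (2 * (m ^ 2 * V) + D) / r) := by gcongr
    _ ≤ s * (r * (89 * (1 / r ^ 4 * h)) + (3 * (1 / (2 * r ^ 2) * h)) / r) := by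
        gcongr
        · linarith
        · linarith
    _ = 181 / 2 * (s * h / r ^ 3) := by field_simp; ring
    _ ≤ 91 * (s * h / r ^ 3) := by gcongr; norm_num
    _ = _ := by ring

lemma heatDiag_le_exp_mul {r : ℝ} (N m : ℕ) (x : ℝ) :
    heatDiag r N m x ≤ Real.exp (-(r ^ 2 * m)) * heatDiag (r / √2) N m x := by
  rw [heatDiag, heatDiag, Finset.mul_sum]
  refine Finset.sum_le_sum fun n hn => ?_
  rw [← mul_assoc, ← Real.exp_add]
  refine mul_le_mul_of_nonneg_right (Real.exp_le_exp.2 ?_) (sq_nonneg _)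
  have h := mul_le_mul_of_nonneg_left (natCast_le_eigenL (Finset.mem_filter.1 hn).2) (sq_nonneg r)
  rw [div_pow, Real.sq_sqrt (by norm_num)]
  linarith

lemma heatDiag_antitone {r s : ℝ} (hr : 0 ≤ r) (hrs : r ≤ s) (N m : ℕ) (x : ℝ) :
    heatDiag s N m x ≤ heatDiag r N m x := by
  refine Finset.sum_le_sum fun n hn => ?_
  have h := (Nat.cast_nonneg m).trans (natCast_le_eigenL (Finset.mem_filter.1 hn).2)
  gcongr

lemma heatDiag_succ_le_of_half_le {r : ℝ} (hr : 0 < r) (N k : ℕ) {x : ℝ}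
    (hx : x ∈ Icc (-1 : ℝ) 1) (hy : 1 / 2 ≤ √(1 - x ^ 2)) :
    heatDiag r N (k + 1) x ≤ 12 / r * Real.exp (-(r ^ 2 * (k + 1))) := by
  have h1 := heatDiag_le_exp_mul (r := r) N (k + 1) x
  have h2 := sqrt_mul_heatDiag_le (r := r / √2) (by positivity) N k hx
  have h3 := mul_le_mul_of_nonneg_right hy (heatDiag_nonneg (r / √2) N (k + 1) x)
  have h4 : √2 ≤ 3 / 2 := Real.sqrt_le_iff.2 (by norm_num)
  have h5 : 4 / (r / √2) ≤ 6 / r := by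
    rw [div_div_eq_mul_div]
    gcongr
    linarith
  have h6 : heatDiag (r / √2) N (k + 1) x ≤ 12 / r := by
    have : 12 / r = 2 * (6 / r) := by ring
    linarith
  push_cast at h1
  rw [mul_comm]
  exact h1.trans (mul_le_mul_of_nonneg_left h6 (Real.exp_nonneg _))

lemma sum_exp_neg_le {t : ℝ} (ht : 0 < t) (K : ℕ) :
    ∑ k ∈ Finset.range K, Real.exp (-(t * (k + 1))) ≤ 1 / t := by
  have h : ∀ k : ℕ, Real.exp (-(t * (k + 1))) ≤
      1 / t * Real.exp (-(t * k)) - 1 / t * Real.exp (-(t * (k + 1 : ℕ))) := fun k => by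
    have e : Real.exp (-(t * k)) = Real.exp t * Real.exp (-(t * (k + 1))) := by
      rw [← Real.exp_add]; ring_nf
    push_cast
    rw [e, ← mul_sub, ← sub_one_mul, ← mul_assoc]
    refine le_mul_of_one_le_left (Real.exp_nonneg _) ?_
    rw [one_div_mul_eq_div, le_div_iff₀ ht]
    linarith [Real.add_one_le_exp t]
  refine (Finset.sum_le_sum fun k _ => h k).trans ?_
  rw [Finset.sum_range_sub' fun k : ℕ => 1 / t * Real.exp (-(t * k))]
  have : 0 ≤ 1 / t * Real.exp (-(t * K)) := by positivity
  simpa using this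

lemma sum_heatDiag_le_near {r : ℝ} (hr : 0 < r) (N K : ℕ) {x : ℝ}
    (hx : x ∈ Icc (-1 : ℝ) 1) (hy : 1 / 2 ≤ √(1 - x ^ 2)) :
    ∑ k ∈ Finset.range K, heatDiag r N (k + 1) x ≤ 12 / r ^ 3 := by
  refine (Finset.sum_le_sum fun k _ => heatDiag_succ_le_of_half_le hr N k hx hy).trans ?_
  rw [← Finset.mul_sum]
  refine (mul_le_mul_of_nonneg_left (sum_exp_neg_le (pow_pos hr 2) K) (by positivity)).trans ?_
  rw [div_mul_div_comm, mul_one, ← pow_succ']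

lemma heatDiag_le_far {r : ℝ} (hr : 0 < r) (N k : ℕ) {x : ℝ} (hx : x ∈ Icc (-1 : ℝ) 1)
    (hx0 : x ≠ 0) :
    heatDiag r N (k + 2) x ≤ 190 * √(1 - x ^ 2) / (r * (r * |x|)) *
      (1 / (√(1 - x ^ 2) + (k + 1) * (r * |x|)) - 1 / (√(1 - x ^ 2) + (k + 2) * (r * |x|))) := by
  have h1 := sqrt_mul_heatDiag_le hr N (k + 1) hx
  have h2 := sq_mul_heatDiag_le hr N k hx
  rw [show k + 1 + 1 = k + 2 by ring] at h1
  have hH := heatDiag_nonneg r N (k + 2) x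
  have hs : 0 ≤ √(1 - x ^ 2) := Real.sqrt_nonneg _
  have hk : (0 : ℝ) ≤ k := Nat.cast_nonneg k
  have hκ : 0 < r * |x| := mul_pos hr (abs_pos.2 hx0)
  have hκ2 : (r * |x|) ^ 2 = r ^ 2 * x ^ 2 := by rw [mul_pow, sq_abs]
  set H := heatDiag r N (k + 2) x
  set s := √(1 - x ^ 2)
  set κ := r * |x|
  have h3 : s ^ 2 * H ≤ 4 * (s / r) := by
    calc s ^ 2 * H = s * (s * H) := by ring
      _ ≤ s * (4 / r) := by gcongr
      _ = _ := by ring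
  have h4 : ((k : ℝ) + 2) ^ 2 * κ ^ 2 * H ≤ 91 * (s / r) := by
    calc ((k : ℝ) + 2) ^ 2 * κ ^ 2 * H = r ^ 2 * (((k : ℝ) + 2) ^ 2 * x ^ 2 * H) := by
          rw [hκ2]; ring
      _ ≤ r ^ 2 * (91 * s / r ^ 3) := by gcongr
      _ = _ := by field_simp
  have h5 : H * (s + (k + 2) * κ) ^ 2 ≤ 190 * (s / r) := by
    nlinarith [mul_nonneg hH (sq_nonneg (s - (k + 2) * κ))]
  have h6 : 0 < s + (k + 2) * κ := by positivity
  have h7 : 0 < s + (k + 1) * κ := by positivity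
  have e : 190 * s / (r * κ) * (1 / (s + (k + 1) * κ) - 1 / (s + (k + 2) * κ)) =
      190 * (s / r) / ((s + (k + 1) * κ) * (s + (k + 2) * κ)) := by
    field_simp
    ring
  rw [e, le_div_iff₀ (by positivity)]
  refine le_trans (mul_le_mul_of_nonneg_left ?_ hH) h5
  rw [sq]
  gcongr
  linarith

lemma sum_heatDiag_le_far {r : ℝ} (hr : 0 < r) (N K : ℕ) {x : ℝ} (hx : x ∈ Icc (-1 : ℝ) 1)
    (hx0 : x ≠ 0) :
    ∑ k ∈ Finset.range K, heatDiag r N (k + 2) x ≤ 190 / (r ^ 2 * |x|) := by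
  have hs : 0 ≤ √(1 - x ^ 2) := Real.sqrt_nonneg _
  have hx1 : 0 < |x| := abs_pos.2 hx0
  have hκ : 0 < r * |x| := mul_pos hr hx1
  refine (Finset.sum_le_sum fun k _ => heatDiag_le_far hr N k hx hx0).trans ?_
  rw [← Finset.mul_sum]
  set s := √(1 - x ^ 2)
  have h1 : ∀ k : ℕ, 1 / (s + (k + 1) * (r * |x|)) - 1 / (s + (k + 2) * (r * |x|)) =
      1 / (s + (k + 1) * (r * |x|)) - 1 / (s + ((k + 1 : ℕ) + 1) * (r * |x|)) := fun k => by
    push_cast; ring_nf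
  rw [Finset.sum_congr rfl fun k _ => h1 k,
    Finset.sum_range_sub' fun k : ℕ => 1 / (s + (k + 1) * (r * |x|))]
  have h2 : 0 ≤ 1 / (s + (K + 1) * (r * |x|)) := by positivity
  calc _ ≤ 190 * s / (r * (r * |x|)) * (1 / (s + r * |x|)) := by
        gcongr
        simpa using h2
    _ = 190 / (r ^ 2 * |x|) * (s / (s + r * |x|)) := by ring
    _ ≤ 190 / (r ^ 2 * |x|) * 1 := by
        gcongr
        exact div_le_one_of_le₀ (by linarith) (by positivity)
    _ = _ := mul_one _

lemma zonal_term_le {t : ℝ} (ht : 0 < t) (ht1 : t ≤ 1) (n : ℕ) :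
    (2 * (n : ℝ) + 1) * Real.exp (-(t * (n * (n + 1)))) ≤
      8 / t * (1 / (1 + t * (n : ℝ) ^ 2)) - 8 / t * (1 / (1 + t * ((n + 1 : ℕ) : ℝ) ^ 2)) := by
  have hn : (0 : ℝ) ≤ n := Nat.cast_nonneg n
  set Y := t * (n * ((n : ℝ) + 1)) with hY
  have hY0 : 0 ≤ Y := by positivity
  have h1 : (1 + Y) ^ 2 ≤ 4 * Real.exp Y := by
    have h := pow_le_pow_left₀ (by positivity) (Real.add_one_le_exp (Y / 2)) 2
    rw [← Real.exp_nat_mul, show ((2 : ℕ) : ℝ) * (Y / 2) = Y by push_cast; ring] at h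
    nlinarith
  have h2 : 1 + t * (n : ℝ) ^ 2 ≤ 1 + Y := by rw [hY]; nlinarith [mul_nonneg ht.le hn]
  have h3 : 1 + t * ((n : ℝ) + 1) ^ 2 ≤ 2 * (1 + Y) := by
    rcases Nat.eq_zero_or_pos n with rfl | h
    · simp [hY]
      linarith
    · have h' : (1 : ℝ) ≤ n := by exact_mod_cast h
      rw [hY]
      nlinarith [mul_nonneg ht.le (mul_nonneg (sub_nonneg.2 h') (by linarith : 0 ≤ (n : ℝ) + 1))]
  have h4 : (1 + t * (n : ℝ) ^ 2) * (1 + t * ((n : ℝ) + 1) ^ 2) ≤ 8 * Real.exp Y := by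
    calc _ ≤ (1 + Y) * (2 * (1 + Y)) := by gcongr
      _ = 2 * (1 + Y) ^ 2 := by ring
      _ ≤ _ := by linarith
  have e : 8 / t * (1 / (1 + t * (n : ℝ) ^ 2)) - 8 / t * (1 / (1 + t * ((n + 1 : ℕ) : ℝ) ^ 2)) =
      (2 * n + 1) * (8 / ((1 + t * (n : ℝ) ^ 2) * (1 + t * ((n : ℝ) + 1) ^ 2))) := by
    push_cast
    field_simp
    ring
  rw [e, Real.exp_neg]
  refine mul_le_mul_of_nonneg_left ?_ (by positivity)
  rw [le_div_iff₀ (by positivity), inv_mul_le_iff₀ (Real.exp_pos _)]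
  linarith

lemma sum_zonal_le {t : ℝ} (ht : 0 < t) (ht1 : t ≤ 1) (N : ℕ) :
    ∑ n ∈ Finset.range N, (2 * (n : ℝ) + 1) * Real.exp (-(t * (n * (n + 1)))) ≤ 8 / t := by
  refine (Finset.sum_le_sum fun n _ => zonal_term_le ht ht1 n).trans ?_
  rw [Finset.sum_range_sub' fun n : ℕ => 8 / t * (1 / (1 + t * (n : ℝ) ^ 2))]
  have : 0 ≤ 8 / t * (1 / (1 + t * (N : ℝ) ^ 2)) := by positivity
  simpa using this

lemma heatDiag_le_of_le_one {r : ℝ} (hr : 0 < r) (hr1 : r ≤ 1) (N : ℕ) {m : ℕ} (hm : m ≤ 1)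
    {x : ℝ} (hx : x ∈ Icc (-1 : ℝ) 1) : heatDiag r N m x ≤ 8 / r ^ 2 := by
  refine le_trans ?_ (sum_zonal_le (pow_pos hr 2) (pow_le_one₀ hr.le hr1) (N + 1))
  refine (Finset.sum_le_sum fun n hn => ?_).trans
    (Finset.sum_le_sum_of_subset_of_nonneg (Finset.filter_subset (m ≤ ·) _)
      fun n _ _ => by positivity)
  have hmn := (Finset.mem_filter.1 hn).2
  rw [mul_comm]
  have h1 : tY n m x ^ 2 ≤ 2 * n + 1 := by
    interval_cases m
    · exact tY_zero_sq_le n hx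
    · exact tY_one_sq_le hmn hx
  have h2 : (n : ℝ) * (n + 1) ≤ 2 * eigenL n m := by
    interval_cases m
    · have : (0 : ℝ) ≤ n := Nat.cast_nonneg n
      simp only [eigenL]
      push_cast
      nlinarith
    · have : (1 : ℝ) ≤ n := by exact_mod_cast hmn
      simp only [eigenL]
      push_cast
      nlinarith
  have h3 := mul_le_mul_of_nonneg_left h2 (sq_nonneg r)
  refine mul_le_mul h1 (Real.exp_le_exp.2 ?_) (Real.exp_nonneg _) (by positivity)
  linarith

lemma sum_heatDiag_split {r : ℝ} (hr : 0 < r) (hr1 : r ≤ 1) (N : ℕ) {x : ℝ}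
    (hx : x ∈ Icc (-1 : ℝ) 1) :
    ∑ m ∈ Finset.range (N + 1), heatDiag r N m x ≤
      16 / r ^ 2 + ∑ k ∈ Finset.range N, heatDiag r N (k + 2) x := by
  have h0 := heatDiag_le_of_le_one hr hr1 N (Nat.zero_le 1) hx
  have h1 := heatDiag_le_of_le_one hr hr1 N le_rfl hx
  have h2 : ∑ m ∈ Finset.range (N + 1), heatDiag r N m x ≤
      ∑ m ∈ Finset.range (N + 2), heatDiag r N m x :=
    Finset.sum_le_sum_of_subset_of_nonneg (Finset.range_mono (by lia))
      fun m _ _ => heatDiag_nonneg r N m x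
  rw [Finset.sum_range_succ' _ (N + 1),
    Finset.sum_range_succ' (fun k => heatDiag r N (k + 1) x) N] at h2
  have : 16 / r ^ 2 = 8 / r ^ 2 + 8 / r ^ 2 := by ring
  linarith

lemma sum_heatDiag_le_of_le_one {r : ℝ} (hr : 0 < r) (hr1 : r ≤ 1) (N : ℕ) {θ : ℝ}
    (hθ : θ ∈ Icc (-(Real.pi / 2)) (Real.pi / 2)) :
    2 * ∑ m ∈ Finset.range (N + 1), heatDiag r N m (Real.sin θ) ≤
      1000 / (r ^ 2 * max r |θ|) := by
  have hx : Real.sin θ ∈ Icc (-1 : ℝ) 1 := Real.sin_mem_Icc θ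
  have hcos : √(1 - Real.sin θ ^ 2) = Real.cos θ := by
    rw [← Real.cos_sq', Real.sqrt_sq (Real.cos_nonneg_of_mem_Icc hθ)]
  have hsplit := sum_heatDiag_split hr hr1 N hx
  have hpi := Real.pi_lt_d2
  rcases le_or_gt |θ| r with h | h
  · rw [max_eq_left h]
    have hc : 1 / 2 ≤ √(1 - Real.sin θ ^ 2) := by
      rw [hcos, ← Real.cos_pi_div_three, ← Real.cos_abs θ]
      exact Real.cos_le_cos_of_nonneg_of_le_pi (abs_nonneg θ) (by linarith [Real.pi_pos])
        (by linarith [Real.pi_gt_three])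
    have h1 := sum_heatDiag_le_near hr N (N + 1) hx hc
    rw [Finset.sum_range_succ'] at h1
    have h2 := heatDiag_nonneg r N (0 + 1) (Real.sin θ)
    have h3 : 16 / r ^ 2 ≤ 16 / r ^ 3 := by
      gcongr 16 / ?_
      exact pow_le_pow_of_le_one hr.le hr1 (by norm_num)
    have h4 : 1000 / (r ^ 2 * r) = 944 / r ^ 3 + 2 * (16 / r ^ 3 + 12 / r ^ 3) := by ring
    have h5 : 0 ≤ 944 / r ^ 3 := by positivity
    rw [h4]
    have h6 : ∀ k : ℕ, k + 1 + 1 = k + 2 := fun k => rfl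
    simp only [h6] at h1
    linarith
  · rw [max_eq_right h.le]
    have hθ0 : 0 < |θ| := hr.trans h
    have hθ2 : |θ| ≤ Real.pi / 2 := abs_le.2 hθ
    have hsin : |θ| / 1.6 ≤ |Real.sin θ| := by
      rw [Real.abs_sin_eq_sin_abs_of_abs_le_pi (by linarith [Real.pi_pos])]
      refine le_trans ?_ (Real.mul_le_sin hθ0.le hθ2)
      rw [div_mul_eq_mul_div, div_le_div_iff₀ (by norm_num) Real.pi_pos]
      nlinarith
    have hsin0 : 0 < |Real.sin θ| := lt_of_lt_of_le (by positivity) hsin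
    have h1 := sum_heatDiag_le_far hr N N hx (abs_pos.1 hsin0)
    have h2 : 190 / (r ^ 2 * |Real.sin θ|) ≤ 304 / (r ^ 2 * |θ|) := by
      calc 190 / (r ^ 2 * |Real.sin θ|) ≤ 190 / (r ^ 2 * (|θ| / 1.6)) := by gcongr
        _ = _ := by field_simp; norm_num
    have h3 : 16 / r ^ 2 ≤ 32 / (r ^ 2 * |θ|) := by
      rw [div_le_div_iff₀ (by positivity) (by positivity)]
      nlinarith [pow_pos hr 2]
    have h4 : 1000 / (r ^ 2 * |θ|) =
      328 / (r ^ 2 * |θ|) + 2 * (32 / (r ^ 2 * |θ|) + 304 / (r ^ 2 * |θ|)) := by ring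
    have h5 : 0 ≤ 328 / (r ^ 2 * |θ|) := by positivity
    linarith

/-- The diagonal of the heat kernel is controlled by the inverse of the ball volume. -/
lemma sum_heatDiag_le {r : ℝ} (hr : 0 < r) (N : ℕ) {θ : ℝ}
    (hθ : θ ∈ Icc (-(Real.pi / 2)) (Real.pi / 2)) :
    2 * ∑ m ∈ Finset.range (N + 1), heatDiag r N m (Real.sin θ) ≤
      1000 / min 1 (r ^ 2 * max r |θ|) := by
  have hmin : ∀ s : ℝ, 0 < s → 0 < s ^ 2 * max s |θ| := fun s hs =>
    mul_pos (pow_pos hs 2) (lt_max_of_lt_left hs)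
  rcases le_total r 1 with h | h
  · refine (sum_heatDiag_le_of_le_one hr h N hθ).trans ?_
    have := lt_min one_pos (hmin r hr)
    gcongr
    exact min_le_right _ _
  · have h1 : 1 ≤ r ^ 2 * max r |θ| :=
      one_le_mul_of_one_le_of_one_le (one_le_pow₀ h) (h.trans (le_max_left _ _))
    rw [min_eq_left h1, div_one]
    have h2 := sum_heatDiag_le_of_le_one one_pos le_rfl N hθ
    have h3 : (1000 : ℝ) / (1 ^ 2 * max 1 |θ|) ≤ 1000 :=
      div_le_self (by norm_num) (by rw [one_pow, one_mul]; exact le_max_left _ _)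
    refine le_trans ?_ (h2.trans h3)
    gcongr with m _
    exact heatDiag_antitone zero_le_one h N m _

lemma exp_arg_mul_I_of_pos {c : ℝ} (hc : 0 < c) (φ : ℝ) :
    Complex.exp (Complex.I * (Complex.arg (((c * Real.cos φ : ℝ) : ℂ) +
      ((c * Real.sin φ : ℝ) : ℂ) * Complex.I) : ℂ)) = Complex.exp (Complex.I * φ) := by
  have e : ((c * Real.cos φ : ℝ) : ℂ) + ((c * Real.sin φ : ℝ) : ℂ) * Complex.I =
      (c : ℂ) * Complex.exp (φ * Complex.I) := by
    rw [Complex.exp_mul_I]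
    push_cast
    ring
  have h := Complex.norm_mul_exp_arg_mul_I (Complex.exp (φ * Complex.I))
  rw [Complex.norm_exp_ofReal_mul_I, Complex.ofReal_one, one_mul] at h
  rw [e, Complex.arg_real_mul _ hc, mul_comm Complex.I, h, mul_comm Complex.I]

lemma Ylm_spt_of_cos_pos (n : ℕ) (m : ℤ) {θ : ℝ} (hθ : 0 < Real.cos θ) (φ : ℝ) :
    Ylm n m (spt θ φ) = Complex.exp (Complex.I * φ) ^ m * (tY n m (Real.sin θ) : ℂ) := by
  rw [← exp_arg_mul_I_of_pos hθ φ, ← Complex.exp_int_mul, Ylm]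
  simp only [spt, WithLp.equiv_symm_apply, PiLp.toLp_apply, Matrix.cons_val_zero,
    Matrix.cons_val_one, Matrix.cons_val_two]
  congr 2
  ring

lemma norm_Ylm (n : ℕ) (m : ℤ) (z : E3) : ‖Ylm n m z‖ ^ 2 = tY n m (z 2) ^ 2 := by
  have h : Complex.I * (m : ℂ) * (Complex.arg ((z 0 : ℂ) + (z 1 : ℂ) * Complex.I) : ℂ) =
      ((m * Complex.arg ((z 0 : ℂ) + (z 1 : ℂ) * Complex.I) : ℝ) : ℂ) * Complex.I := by
    push_cast
    ring
  rw [Ylm, norm_mul, h, Complex.norm_exp_ofReal_mul_I, one_mul, Complex.norm_real,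
    Real.norm_eq_abs, sq_abs]

lemma spt_apply_two (θ φ : ℝ) : spt θ φ 2 = Real.sin θ := rfl

lemma continuous_tY {n : ℕ} {m : ℤ} (hm : m.natAbs ≤ n) : Continuous (tY n m) := by
  have h : ∀ k : ℕ, Continuous (tY n k) := fun k => by
    rw [funext (tY_natCast n k)]
    fun_prop
  obtain ⟨k, rfl | rfl⟩ := m.eq_nat_or_neg
  · exact h k
  · rw [Int.natAbs_neg, Int.natAbs_natCast] at hm
    rw [funext (tY_neg_natCast hm)]
    exact (h k).const_mul _

lemma measurable_Ylm {n : ℕ} {m : ℤ} (hm : m.natAbs ≤ n) : Measurable (Ylm n m) := by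
  have h := (continuous_tY hm).measurable
  unfold Ylm
  fun_prop

lemma continuous_spt : Continuous fun p : ℝ × ℝ => spt p.1 p.2 := by
  refine (PiLp.continuous_toLp 2 _).comp (continuous_pi fun i => ?_)
  fin_cases i <;> simp <;> fun_prop

lemma lintegral_sphereMeasure {f : E3 → ℝ≥0∞} (hf : Measurable f) :
    ∫⁻ z, f z ∂sphereMeasure = ∫⁻ p in Ioc (-(Real.pi / 2)) (Real.pi / 2) ×ˢ Ico 0 (2 * Real.pi),
      ENNReal.ofReal (Real.cos p.1) * f (spt p.1 p.2) := by
  rw [sphereMeasure, lintegral_map hf continuous_spt.measurable,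
    lintegral_withDensity_eq_lintegral_mul _ (by fun_prop)
      (hf.fun_comp continuous_spt.measurable)]
  rfl

lemma setIntegral_cos_mul_tY {n n' : ℕ} {m : ℤ} (hn : m.natAbs ≤ n) (hn' : m.natAbs ≤ n') :
    ∫ θ in Ioc (-(Real.pi / 2)) (Real.pi / 2),
      Real.cos θ * tY n m (Real.sin θ) * tY n' m (Real.sin θ) =
      if n = n' then (2 * Real.pi)⁻¹ else 0 := by
  have h1 : ∀ x ∈ Icc (-1 : ℝ) 1, tY n m x * tY n' m x =
      (wPoly ^ m.natAbs * sphPoly n m.natAbs * sphPoly n' m.natAbs).eval x := fun x hx => by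
    rw [← tY_natCast_mul hx]
    obtain ⟨k, rfl | rfl⟩ := m.eq_nat_or_neg
    · simp
    · rw [Int.natAbs_neg, Int.natAbs_natCast] at *
      rw [tY_neg_natCast hn, tY_neg_natCast hn', mul_mul_mul_comm, ← mul_pow]
      simp
  have h2 : ∀ θ : ℝ, Real.cos θ * tY n m (Real.sin θ) * tY n' m (Real.sin θ) =
      ((fun x => (wPoly ^ m.natAbs * sphPoly n m.natAbs * sphPoly n' m.natAbs).eval x) ∘ Real.sin) θ
        * Real.cos θ := fun θ => by
    rw [mul_assoc, h1 _ (Real.sin_mem_Icc θ), mul_comm]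
    rfl
  simp only [h2]
  rw [← intervalIntegral.integral_of_le (by linarith [Real.pi_pos]),
    intervalIntegral.integral_comp_mul_deriv (fun x _ => Real.hasDerivAt_sin x)
      Real.continuous_cos.continuousOn (by fun_prop), Real.sin_neg, Real.sin_pi_div_two]
  change polyInt _ = _
  split_ifs with h
  · subst h
    rw [← polyInt_sphPoly_sq hn]
  · exact polyInt_sphPoly_of_ne _ h

lemma setIntegral_exp_zpow (m m' : ℤ) :
    ∫ φ in Ico 0 (2 * Real.pi), Complex.exp (Complex.I * φ) ^ m *
      (starRingEnd ℂ) (Complex.exp (Complex.I * φ) ^ m') =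
      if m = m' then (2 * Real.pi : ℂ) else 0 := by
  have h : ∀ φ : ℝ, Complex.exp (Complex.I * φ) ^ m *
      (starRingEnd ℂ) (Complex.exp (Complex.I * φ) ^ m') =
      Complex.exp (((m - m' : ℤ) : ℂ) * Complex.I * φ) := fun φ => by
    rw [map_zpow₀, ← Complex.exp_conj, map_mul, Complex.conj_I, Complex.conj_ofReal,
      ← Complex.exp_int_mul, ← Complex.exp_int_mul, ← Complex.exp_add]
    push_cast
    ring_nf
  simp only [h]
  rw [integral_Ico_eq_integral_Ioc, ← intervalIntegral.integral_of_le (by positivity)]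
  split_ifs with hm
  · simp [hm]
  · have hc : ((m - m' : ℤ) : ℂ) * Complex.I ≠ 0 :=
      mul_ne_zero (Int.cast_ne_zero.2 (sub_ne_zero.2 hm)) Complex.I_ne_zero
    rw [integral_exp_mul_complex hc]
    have e : ((m - m' : ℤ) : ℂ) * Complex.I * ((2 * Real.pi : ℝ) : ℂ) =
      ((m - m' : ℤ) : ℂ) * (2 * Real.pi * Complex.I) := by push_cast; ring
    rw [e, Complex.exp_int_mul_two_pi_mul_I]
    simp

/-- The spherical harmonic in spherical coordinates. -/
def angularY (p : ℕ × ℤ) (u : ℝ × ℝ) : ℂ :=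
  Complex.exp (Complex.I * u.2) ^ p.2 * (tY p.1 p.2 (Real.sin u.1) : ℂ)

lemma continuous_angularY {p : ℕ × ℤ} (hp : p.2.natAbs ≤ p.1) : Continuous (angularY p) := by
  have h := continuous_tY hp
  refine Continuous.mul ?_ (Complex.continuous_ofReal.comp (h.comp (by fun_prop)))
  exact Continuous.zpow₀ (by fun_prop) _ fun _ => Or.inl (Complex.exp_ne_zero _)

lemma setIntegral_cos_mul_angularY {p p' : ℕ × ℤ} (hp : p.2.natAbs ≤ p.1)
    (hp' : p'.2.natAbs ≤ p'.1) :
    ∫ u in Ioc (-(Real.pi / 2)) (Real.pi / 2) ×ˢ Ico 0 (2 * Real.pi),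
      (Real.cos u.1 : ℂ) * (angularY p u * (starRingEnd ℂ) (angularY p' u)) =
      if p = p' then 1 else 0 := by
  have h : ∀ u : ℝ × ℝ, (Real.cos u.1 : ℂ) * (angularY p u * (starRingEnd ℂ) (angularY p' u)) =
      ((Real.cos u.1 * tY p.1 p.2 (Real.sin u.1) * tY p'.1 p'.2 (Real.sin u.1) : ℝ) : ℂ) *
      (Complex.exp (Complex.I * u.2) ^ p.2 *
        (starRingEnd ℂ) (Complex.exp (Complex.I * u.2) ^ p'.2)) := fun u => by
    simp only [angularY, map_mul, Complex.conj_ofReal]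
    push_cast
    ring
  simp only [h]
  rw [Measure.volume_eq_prod, setIntegral_prod_mul
    (fun θ : ℝ => ((Real.cos θ * tY p.1 p.2 (Real.sin θ) * tY p'.1 p'.2 (Real.sin θ) : ℝ) : ℂ))
    (fun φ : ℝ => Complex.exp (Complex.I * φ) ^ p.2 *
        (starRingEnd ℂ) (Complex.exp (Complex.I * φ) ^ p'.2)),
    setIntegral_exp_zpow, integral_complex_ofReal]
  obtain ⟨n, m⟩ := p
  obtain ⟨n', m'⟩ := p'
  by_cases hm : m = m'
  · subst hm
    rw [setIntegral_cos_mul_tY hp hp']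
    have := Real.pi_ne_zero
    by_cases hn : n = n' <;> simp [hn]
    field_simp
  · simp [hm]

lemma integrableOn_box {f : ℝ × ℝ → ℂ} (hf : Continuous f) :
    IntegrableOn f (Ioc (-(Real.pi / 2)) (Real.pi / 2) ×ˢ Ico 0 (2 * Real.pi)) :=
  (hf.continuousOn.integrableOn_compact (isCompact_Icc.prod isCompact_Icc)).mono_set
    (prod_mono Ioc_subset_Icc_self Ico_subset_Icc_self)

lemma setIntegral_cos_mul_sum_angularY {s : Finset (ℕ × ℤ)} (hs : ∀ p ∈ s, p.2.natAbs ≤ p.1)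
    (c : ℕ × ℤ → ℂ) :
    ∫ u in Ioc (-(Real.pi / 2)) (Real.pi / 2) ×ˢ Ico 0 (2 * Real.pi),
      Real.cos u.1 * ‖∑ p ∈ s, c p * angularY p u‖ ^ 2 = ∑ p ∈ s, ‖c p‖ ^ 2 := by
  have h : ∀ u : ℝ × ℝ, ((Real.cos u.1 * ‖∑ p ∈ s, c p * angularY p u‖ ^ 2 : ℝ) : ℂ) =
      ∑ p ∈ s, ∑ p' ∈ s, c p * (starRingEnd ℂ) (c p') *
        ((Real.cos u.1 : ℂ) * (angularY p u * (starRingEnd ℂ) (angularY p' u))) := fun u => by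
    rw [Complex.ofReal_mul, Complex.ofReal_pow, ← Complex.mul_conj', map_sum, Finset.sum_mul_sum,
      Finset.mul_sum]
    refine Finset.sum_congr rfl fun p _ => ?_
    rw [Finset.mul_sum]
    refine Finset.sum_congr rfl fun p' _ => ?_
    rw [map_mul]
    ring
  have hc : ∀ p ∈ s, ∀ p' ∈ s, Continuous fun u : ℝ × ℝ => c p * (starRingEnd ℂ) (c p') *
      ((Real.cos u.1 : ℂ) * (angularY p u * (starRingEnd ℂ) (angularY p' u))) :=
    fun p hp p' hp' => by
      have h1 := continuous_angularY (hs p hp)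
      have h2 := Complex.continuous_conj.comp (continuous_angularY (hs p' hp'))
      exact continuous_const.mul ((Complex.continuous_ofReal.comp (by fun_prop)).mul (h1.mul h2))
  apply Complex.ofReal_injective
  rw [← integral_complex_ofReal]
  simp only [h]
  rw [integral_finsetSum _ fun p hp => integrable_finsetSum _ fun p' hp' =>
    integrableOn_box (hc p hp p' hp')]
  rw [Complex.ofReal_sum]
  refine Finset.sum_congr rfl fun p hp => ?_
  rw [integral_finsetSum _ fun p' hp' => integrableOn_box (hc p hp p' hp'),
    Finset.sum_eq_single_of_mem p hp]
  · rw [integral_const_mul, setIntegral_cos_mul_angularY (hs p hp) (hs p hp), if_pos rfl, mul_one,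
      Complex.mul_conj', Complex.ofReal_pow]
  · intro p' hp' hne
    rw [integral_const_mul, setIntegral_cos_mul_angularY (hs p hp) (hs p' hp'), if_neg hne.symm,
      mul_zero]

/-- Parseval's identity for finite combinations of spherical harmonics. -/
lemma lintegral_sum_Ylm {s : Finset (ℕ × ℤ)} (hs : ∀ p ∈ s, p.2.natAbs ≤ p.1) (c : ℕ × ℤ → ℂ) :
    ∫⁻ z, (‖∑ p ∈ s, c p * Ylm p.1 p.2 z‖₊ : ℝ≥0∞) ^ 2 ∂sphereMeasure =
      ENNReal.ofReal (∑ p ∈ s, ‖c p‖ ^ 2) := by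
  have hY : Measurable fun z => ∑ p ∈ s, c p * Ylm p.1 p.2 z :=
    Finset.measurable_fun_sum _ fun p hp => (measurable_Ylm (hs p hp)).const_mul _
  have hA : Continuous fun u => ∑ p ∈ s, c p * angularY p u :=
    continuous_finsetSum _ fun p hp => (continuous_angularY (hs p hp)).const_mul _
  have hbox : MeasurableSet
      (Ioc (-(Real.pi / 2)) (Real.pi / 2) ×ˢ Ico 0 (2 * Real.pi) : Set (ℝ × ℝ)) :=
    measurableSet_Ioc.prod measurableSet_Ico
  rw [lintegral_sphereMeasure (by fun_prop), ← setIntegral_cos_mul_sum_angularY hs c,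
    ofReal_integral_eq_lintegral_ofReal]
  · refine setLIntegral_congr_fun hbox fun u hu => ?_
    have hcos : 0 ≤ Real.cos u.1 := Real.cos_nonneg_of_mem_Icc (Ioc_subset_Icc_self hu.1)
    rw [ENNReal.ofReal_mul hcos]
    rcases hcos.eq_or_lt with h0 | h0
    · simp [← h0]
    · congr 1
      simp only [Ylm_spt_of_cos_pos _ _ h0, angularY]
      rw [ENNReal.ofReal_pow (norm_nonneg _), ofReal_norm]
      rfl
  · have h := integrableOn_box (f := fun u => (Real.cos u.1 *
      ‖∑ p ∈ s, c p * angularY p u‖ ^ 2 : ℝ)) (Complex.continuous_ofReal.comp (by fun_prop))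
    exact h.re
  · refine (ae_restrict_iff' hbox).2 (.of_forall fun u hu => ?_)
    have hcos : 0 ≤ Real.cos u.1 := Real.cos_nonneg_of_mem_Icc (Ioc_subset_Icc_self hu.1)
    positivity

/-- The pairs `(n, m)` with `m ≤ n ≤ N`. -/
def natPairs (N : ℕ) : Finset (ℕ × ℕ) :=
  (Finset.range (N + 1) ×ˢ Finset.range (N + 1)).filter fun p => p.2 ≤ p.1

/-- The indices `(n, m)` of spherical harmonics of degree at most `N`. -/
def harmonicPairs (N : ℕ) : Finset (ℕ × ℤ) :=
  (natPairs N).image (fun p => (p.1, (p.2 : ℤ))) ∪ (natPairs N).image fun p => (p.1, -(p.2 : ℤ))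

lemma mem_harmonicPairs {N : ℕ} {p : ℕ × ℤ} :
    p ∈ harmonicPairs N ↔ p.2.natAbs ≤ p.1 ∧ p.1 ≤ N := by
  obtain ⟨n, m⟩ := p
  simp only [harmonicPairs, natPairs, Finset.mem_union, Finset.mem_image, Finset.mem_filter,
    Finset.mem_product, Finset.mem_range, Prod.mk.injEq, Prod.exists]
  constructor
  · rintro (⟨a, b, h, rfl, rfl⟩ | ⟨a, b, h, rfl, rfl⟩) <;> omega
  · intro h
    rcases le_total 0 m with h0 | h0
    · exact Or.inl ⟨n, m.natAbs, by omega, rfl, by omega⟩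
    · exact Or.inr ⟨n, m.natAbs, by omega, rfl, by omega⟩

lemma sum_harmonicPairs_le (N : ℕ) (f : ℕ × ℤ → ℝ) (hf : ∀ p, 0 ≤ f p) :
    ∑ p ∈ harmonicPairs N, f p ≤
      ∑ p ∈ natPairs N, f (p.1, (p.2 : ℤ)) + ∑ p ∈ natPairs N, f (p.1, -(p.2 : ℤ)) := by
  have h := Finset.sum_union_inter (s₁ := (natPairs N).image fun p => (p.1, (p.2 : ℤ)))
    (s₂ := (natPairs N).image fun p => (p.1, -(p.2 : ℤ))) (f := f)
  rw [Finset.sum_image fun a _ b _ hab => by simpa [Prod.ext_iff] using hab,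
    Finset.sum_image fun a _ b _ hab => by simpa [Prod.ext_iff] using hab] at h
  rw [← h]
  exact le_add_of_nonneg_right (Finset.sum_nonneg fun p _ => hf p)

lemma sum_natPairs_eq (N : ℕ) (r x : ℝ) :
    ∑ p ∈ natPairs N, Real.exp (-(2 * r ^ 2 * eigenL p.1 p.2)) * tY p.1 p.2 x ^ 2 =
      ∑ m ∈ Finset.range (N + 1), heatDiag r N m x := by
  simp only [heatDiag, natPairs]
  rw [Finset.sum_filter, Finset.sum_product_right]
  simp only [Finset.sum_filter]

lemma sum_harmonicPairs_tY_le (N : ℕ) (r x : ℝ) :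
    ∑ p ∈ harmonicPairs N, Real.exp (-(2 * r ^ 2 * eigenL p.1 p.2)) * tY p.1 p.2 x ^ 2 ≤
      2 * ∑ m ∈ Finset.range (N + 1), heatDiag r N m x := by
  refine (sum_harmonicPairs_le N _ fun p => by positivity).trans (le_of_eq ?_)
  rw [← sum_natPairs_eq, two_mul (Finset.sum _ _), add_right_inj]
  refine Finset.sum_congr rfl fun p hp => ?_
  have hp' : p.2 ≤ p.1 := (Finset.mem_filter.1 hp).2
  have h : (-(p.2 : ℤ)).natAbs ≤ p.1 := by omega
  rw [tY_sq h, Int.natAbs_neg, Int.natAbs_natCast]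
  simp [eigenL]

/-- The truncation of the heat kernel to degrees at most `N`. -/
def heatKerTrunc (r : ℝ) (N : ℕ) (z z' : E3) : ℂ :=
  ∑ p ∈ harmonicPairs N, (Real.exp (-(r ^ 2 * eigenL p.1 p.2)) : ℂ) *
    (starRingEnd ℂ) (Ylm p.1 p.2 z') * Ylm p.1 p.2 z

lemma measurable_heatKerTrunc (r : ℝ) (N : ℕ) (z' : E3) :
    Measurable fun z => heatKerTrunc r N z z' :=
  Finset.measurable_fun_sum _ fun _ hp =>
    (measurable_Ylm (mem_harmonicPairs.1 hp).1).const_mul _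

lemma lintegral_heatKerTrunc_le {r : ℝ} (hr : 0 < r) (N : ℕ) {θ : ℝ}
    (hθ : θ ∈ Icc (-(Real.pi / 2)) (Real.pi / 2)) (φ : ℝ) :
    ∫⁻ z, (‖heatKerTrunc r N z (spt θ φ)‖₊ : ℝ≥0∞) ^ 2 ∂sphereMeasure ≤
      ENNReal.ofReal (1000 / min 1 (r ^ 2 * max r |θ|)) := by
  simp only [heatKerTrunc]
  rw [lintegral_sum_Ylm (fun p hp => (mem_harmonicPairs.1 hp).1) fun p =>
    (Real.exp (-(r ^ 2 * eigenL p.1 p.2)) : ℂ) * (starRingEnd ℂ) (Ylm p.1 p.2 (spt θ φ))]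
  refine ENNReal.ofReal_le_ofReal (le_trans (le_of_eq ?_)
    ((sum_harmonicPairs_tY_le N r (Real.sin θ)).trans (sum_heatDiag_le hr N hθ)))
  refine Finset.sum_congr rfl fun p _ => ?_
  rw [norm_mul, mul_pow, RCLike.norm_conj, norm_Ylm, spt_apply_two, Complex.norm_real,
    Real.norm_eq_abs, Real.abs_exp, ← Real.exp_nat_mul]
  congr 2
  push_cast
  ring

lemma tendsto_heatKerTrunc (r : ℝ) (z z' : E3)
    (h : Summable fun p : {p : ℕ × ℤ // p.2.natAbs ≤ p.1} =>
      (Real.exp (-(r ^ 2 * eigenL p.1.1 p.1.2)) : ℂ) *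
      Ylm p.1.1 p.1.2 z * (starRingEnd ℂ) (Ylm p.1.1 p.1.2 z')) :
    Filter.Tendsto (fun N => heatKerTrunc r N z z') Filter.atTop (nhds (heatKer r z z')) := by
  have hS : Filter.Tendsto
      (fun N => (harmonicPairs N).subtype fun p : ℕ × ℤ => p.2.natAbs ≤ p.1)
      Filter.atTop Filter.atTop := by
    refine Filter.tendsto_atTop_finset_of_monotone (fun N N' hN p hp => ?_) fun p =>
      ⟨p.1.1, Finset.mem_subtype.2 (mem_harmonicPairs.2 ⟨p.2, le_rfl⟩)⟩
    rw [Finset.mem_subtype, mem_harmonicPairs] at *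
    exact ⟨hp.1, hp.2.trans hN⟩
  refine (h.hasSum.comp hS).congr fun N => ?_
  rw [Function.comp_apply, heatKerTrunc,
    Finset.sum_subtype_of_mem (f := fun p : ℕ × ℤ => (Real.exp (-(r ^ 2 * eigenL p.1 p.2)) : ℂ) *
      Ylm p.1 p.2 z * (starRingEnd ℂ) (Ylm p.1 p.2 z')) fun p hp => (mem_harmonicPairs.1 hp).1]
  exact Finset.sum_congr rfl fun p _ => mul_right_comm _ _ _

lemma sq_nnnorm_heatKer_le_liminf (r : ℝ) (z z' : E3) :
    (‖heatKer r z z'‖₊ : ℝ≥0∞) ^ 2 ≤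
      Filter.liminf (fun N => (‖heatKerTrunc r N z z'‖₊ : ℝ≥0∞) ^ 2) Filter.atTop := by
  by_cases h : Summable fun p : {p : ℕ × ℤ // p.2.natAbs ≤ p.1} =>
      (Real.exp (-(r ^ 2 * eigenL p.1.1 p.1.2)) : ℂ) *
      Ylm p.1.1 p.1.2 z * (starRingEnd ℂ) (Ylm p.1.1 p.1.2 z')
  · have h1 := (ENNReal.continuous_pow 2).continuousAt.tendsto.comp
      (tendsto_heatKerTrunc r z z' h).enorm
    exact h1.liminf_eq.ge
  · rw [heatKer, tsum_eq_zero_of_not_summable h]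
    simp

/-- the on-diagonal heat kernel bound
`∫_{S²} |K_{exp(−r²L)}(z,z')|² dσ(z) ≤ C (min{1, r² max{r,|θ'|}})⁻¹`, for `z' = ⟨θ',φ'⟩`;
the right-hand side is the reciprocal of the sub-Riemannian ball volume `V(z',r)`. -/
theorem statement19 :
    ∃ C : ℝ, 0 < C ∧
      ∀ r : ℝ, 0 < r →
        ∀ θ' : ℝ, θ' ∈ Set.Icc (-(Real.pi/2)) (Real.pi/2) → ∀ φ' : ℝ,
          ∫⁻ z, (‖heatKer r z (spt θ' φ')‖₊ : ℝ≥0∞)^2 ∂sphereMeasure ≤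
            ENNReal.ofReal (C / min 1 (r^2 * max r |θ'|)) := by
  refine ⟨1000, by norm_num, fun r hr θ hθ φ => ?_⟩
  refine (lintegral_mono fun z => sq_nnnorm_heatKer_le_liminf r z (spt θ φ)).trans ?_
  refine (lintegral_liminf_le fun N => ?_).trans ?_
  · exact (measurable_heatKerTrunc r N _).nnnorm.coe_nnreal_ennreal.pow_const 2
  · exact Filter.liminf_le_of_le (by isBoundedDefault) fun b hb =>
      let ⟨N, hN⟩ := hb.exists
      hN.trans (lintegral_heatKerTrunc_le hr N hθ φ)
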